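/- arXiv:1906.07881 — 6 statements merged into one kernel-verified Lean document; each statement's English description precedes it below -/
import Mathlib

section
/- (Existence of the patch-size threshold L* for traveling waves when 0≤c<c*.) Assume (H1) and (EXP). Fix r,q,L₀>0 and c with 0 ≤ c < c*, where c* := inf_{μ>0} (∫_ℝ e^{−μ z} k(z) dz − 1 + r)/μ. Fix a C¹ nonincreasing function ρ:ℝ→[0,1] with ρ(x)=1 for x≤0 and ρ(x)=0 for x≥1, and for each L>0 define f_L(x,u) = −q + (r(1−u)+q)·ρ((|x|−L)/L₀). Then there exists L*∈[0,∞) such that: for every L>L*, there exists a bounded C¹ function Φ:ℝ→(0,∞) satisfying c Φ'(ξ)+∫_ℝ k(η−ξ) Φ(η) dη − Φ(ξ) + f_L(ξ,Φ(ξ)) Φ(ξ)=0 for all ξ∈ℝ; and for every L with 0<L<L*, no such function Φ exists. -/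
open MeasureTheory Real Set Filter Topology

noncomputable section

/-- Hypothesis (H1) on the kernel `k`. -/
def H1 (k : ℝ → ℝ) : Prop :=
  ContDiff ℝ 1 k ∧ (∀ z, 0 ≤ k z) ∧ (∀ z, k (-z) = k z) ∧
  (∫ z, k z) = 1 ∧ 0 < k 0 ∧
  ∃ μ M : ℝ, 0 < μ ∧ 0 < M ∧ ∀ z, M < |z| →
    k z < Real.exp (-(μ * |z|)) ∧ |deriv k z| < Real.exp (-(μ * |z|))

/-- Hypothesis (EXP): all exponential moments of `k` are finite. -/
def EXPk (k : ℝ → ℝ) : Prop :=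
  ∀ μ : ℝ, MeasureTheory.Integrable (fun z => Real.exp (μ * z) * k z)

/-- Hypothesis (H2) on the cut-off function `χ`. -/
def IsH2chi (r q L L0 : ℝ) (χ : ℝ → ℝ) : Prop :=
  0 < r ∧ 0 < q ∧ 0 < L ∧ 0 < L0 ∧
  ContDiff ℝ 1 χ ∧ (∀ x, χ x ∈ Set.Icc (0:ℝ) 1) ∧
  (∀ x, χ (-x) = χ x) ∧ (∀ x, |x| ≤ L → χ x = 1) ∧
  (∀ x, L + L0 ≤ |x| → χ x = 0) ∧ AntitoneOn χ (Set.Ici 0)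

/-- The growth function of hypothesis (H2). -/
def fH2 (r q : ℝ) (χ : ℝ → ℝ) : ℝ → ℝ → ℝ :=
  fun x u => -q + (r * (1 - u) + q) * χ x

/-- A bounded positive traveling-wave profile for speed `c`, kernel `k`, growth `f`. -/
def IsTW (c : ℝ) (k : ℝ → ℝ) (f : ℝ → ℝ → ℝ) (Φ : ℝ → ℝ) : Prop :=
  ContDiff ℝ 1 Φ ∧ (∀ ξ, 0 < Φ ξ) ∧ (∃ C, ∀ ξ, Φ ξ ≤ C) ∧
  ∀ ξ, c * deriv Φ ξ + ((∫ η, k (η - ξ) * Φ η) - Φ ξ) + f ξ (Φ ξ) * Φ ξ = 0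

/-- A bounded classical solution of equation (E) on `[0,∞) × ℝ`, with partial
derivatives `vt` (in time) and `vx` (in space). -/
def IsClassicalSol (c : ℝ) (k : ℝ → ℝ) (f : ℝ → ℝ → ℝ) (v vt vx : ℝ → ℝ → ℝ) : Prop :=
  (∃ C, ∀ t ξ, 0 ≤ t → |v t ξ| ≤ C) ∧
  ContinuousOn (fun p : ℝ × ℝ => v p.1 p.2) {p : ℝ × ℝ | 0 ≤ p.1} ∧
  ContinuousOn (fun p : ℝ × ℝ => vt p.1 p.2) {p : ℝ × ℝ | 0 ≤ p.1} ∧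
  ContinuousOn (fun p : ℝ × ℝ => vx p.1 p.2) {p : ℝ × ℝ | 0 ≤ p.1} ∧
  (∀ t ξ, 0 ≤ t → HasDerivWithinAt (fun s => v s ξ) (vt t ξ) (Set.Ici 0) t) ∧
  (∀ t ξ, 0 ≤ t → HasDerivAt (fun y => v t y) (vx t ξ) ξ) ∧
  (∀ t ξ, 0 ≤ t →
    vt t ξ = c * vx t ξ + ((∫ η, k (η - ξ) * v t η) - v t ξ) + f ξ (v t ξ) * v t ξ)

/-- The spreading speed `c*` of the homogeneous equation with growth rate `r`. -/
def cstar (k : ℝ → ℝ) (r : ℝ) : ℝ :=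
  sInf {y : ℝ | ∃ μ : ℝ, 0 < μ ∧ y = ((∫ z, Real.exp (-(μ * z)) * k z) - 1 + r) / μ}

def KK (k φ : ℝ → ℝ) (x : ℝ) : ℝ := ∫ η, k (η - x) * φ η

lemma KK_decay {k : ℝ → ℝ} (hk : H1 k) : ∃ C μ : ℝ, 0 < μ ∧ 0 < C ∧
    ∀ z, |k z| ≤ C * Real.exp (-(μ * |z|)) ∧ |deriv k z| ≤ C * Real.exp (-(μ * |z|)) := by
  obtain ⟨hC, hpos, -, -, -, μ, M, hμ, hM, hb⟩ := hk
  have hd : Continuous (deriv k) := hC.continuous_deriv le_rfl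
  have hcmp : IsCompact (Icc (-M) M) := isCompact_Icc
  obtain ⟨A, hA⟩ := hcmp.exists_bound_of_continuousOn hC.continuous.continuousOn
  obtain ⟨B, hB⟩ := hcmp.exists_bound_of_continuousOn hd.continuousOn
  have key : ∀ (f : ℝ → ℝ) (D : ℝ), (∀ z ∈ Icc (-M) M, ‖f z‖ ≤ D) →
      (∀ z, M < |z| → |f z| ≤ Real.exp (-(μ * |z|))) →
      ∀ z, |f z| ≤ (1 + |D| * Real.exp (μ * M)) * Real.exp (-(μ * |z|)) := by
    intro f D hD hf z
    by_cases hz : M < |z|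
    · refine (hf z hz).trans ?_
      have : 0 ≤ |D| * Real.exp (μ * M) := by positivity
      nlinarith [Real.exp_pos (-(μ * |z|))]
    · have h1 := hD z (abs_le.1 (not_lt.1 hz))
      have h2 : 1 ≤ Real.exp (μ * M) * Real.exp (-(μ * |z|)) := by
        rw [← Real.exp_add]
        apply Real.one_le_exp
        nlinarith [not_lt.1 hz]
      rw [Real.norm_eq_abs] at h1
      have h3 := Real.exp_pos (-(μ * |z|))
      have h4 := le_abs_self D
      have h5 := abs_nonneg D
      nlinarith
  have k1 := key k A hA (fun z hz => by rw [abs_of_nonneg (hpos z)]; exact (hb z hz).1.le)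
  have k2 := key (deriv k) B hB (fun z hz => (hb z hz).2.le)
  refine ⟨(1 + |A| * Real.exp (μ * M)) + (1 + |B| * Real.exp (μ * M)), μ, hμ, by positivity,
    fun z => ⟨(k1 z).trans ?_, (k2 z).trans ?_⟩⟩
  · refine mul_le_mul_of_nonneg_right ?_ (Real.exp_pos _).le
    have : 0 ≤ 1 + |B| * Real.exp (μ * M) := by positivity
    linarith
  · refine mul_le_mul_of_nonneg_right ?_ (Real.exp_pos _).le
    have : 0 ≤ 1 + |A| * Real.exp (μ * M) := by positivity
    linarith

lemma integrable_exp_neg_abs' {μ : ℝ} (hμ : 0 < μ) :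
    Integrable (fun z : ℝ => Real.exp (-(μ * |z|))) := by
  rw [← integrableOn_univ, ← Iic_union_Ioi (a := (0:ℝ))]
  refine IntegrableOn.union ?_ ?_
  · refine (integrableOn_exp_mul_Iic hμ 0).congr_fun (fun x hx => ?_) measurableSet_Iic
    simp only [mem_Iic] at hx
    simp [abs_of_nonpos hx]
  · refine (integrableOn_exp_mul_Ioi (neg_lt_zero.2 hμ) 0).congr_fun (fun x hx => ?_)
      measurableSet_Ioi
    simp only [mem_Ioi] at hx
    simp [abs_of_pos hx]

lemma H1.integrable {k : ℝ → ℝ} (hk : H1 k) : Integrable k := by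
  obtain ⟨C, μ, hμ, hC, h⟩ := KK_decay hk
  refine ((integrable_exp_neg_abs' hμ).const_mul C).mono' hk.1.continuous.aestronglyMeasurable
    (Eventually.of_forall fun z => (h z).1)

/-- admissible functions -/
def Adm (φ : ℝ → ℝ) : Prop := Measurable φ ∧ ∀ x, 0 ≤ φ x ∧ φ x ≤ 1

lemma KK_int {k φ : ℝ → ℝ} (hk : H1 k) (hφ : Adm φ) (x : ℝ) :
    Integrable (fun η => k (η - x) * φ η) := by
  refine (hk.integrable.comp_sub_right x).mul_bdd (c := 1) hφ.1.aestronglyMeasurable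
    (Eventually.of_forall fun z => ?_)
  rw [Real.norm_eq_abs, abs_of_nonneg (hφ.2 z).1]; exact (hφ.2 z).2

lemma KK_mono {k φ ψ : ℝ → ℝ} (hk : H1 k) (hφ : Adm φ) (hψ : Adm ψ) (h : ∀ x, φ x ≤ ψ x) (x : ℝ) :
    KK k φ x ≤ KK k ψ x :=
  integral_mono (KK_int hk hφ x) (KK_int hk hψ x)
    (fun z => mul_le_mul_of_nonneg_left (h z) (hk.2.1 _))

lemma KK_nonneg {k φ : ℝ → ℝ} (hk : H1 k) (hφ : Adm φ) (x : ℝ) : 0 ≤ KK k φ x :=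
  integral_nonneg (fun z => mul_nonneg (hk.2.1 _) (hφ.2 z).1)

lemma KK_one {k : ℝ → ℝ} (hk : H1 k) (x : ℝ) : KK k (fun _ => 1) x = 1 := by
  simp only [KK, mul_one]
  rw [integral_sub_right_eq_self (fun z => k z) x]
  exact hk.2.2.2.1

lemma adm_one : Adm (fun _ => 1) := ⟨measurable_const, fun _ => by norm_num⟩

lemma KK_le_one {k φ : ℝ → ℝ} (hk : H1 k) (hφ : Adm φ) (x : ℝ) : KK k φ x ≤ 1 :=
  (KK_mono hk hφ adm_one (fun x => (hφ.2 x).2) x).trans (KK_one hk x).le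

lemma KK_contDiff {k φ : ℝ → ℝ} (hk : H1 k) (hφ : Adm φ) : ContDiff ℝ 1 (KK k φ) := by
  obtain ⟨C, μ, hμ, hC, hb⟩ := KK_decay hk
  have hd : Continuous (deriv k) := hk.1.continuous_deriv le_rfl
  have hkd : ∀ x, HasDerivAt k (deriv k x) x := fun x =>
    (hk.1.differentiable one_ne_zero x).hasDerivAt
  have hφ1 : ∀ x, |φ x| ≤ 1 := fun x => by rw [abs_of_nonneg (hφ.2 x).1]; exact (hφ.2 x).2
  let bd : ℝ → ℝ → ℝ := fun x₀ η => C * Real.exp μ * Real.exp (-(μ * |η - x₀|))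
  have hbd : ∀ x₀, Integrable (bd x₀) := fun x₀ =>
    ((integrable_exp_neg_abs' hμ).comp_sub_right x₀).const_mul _
  have hbound : ∀ x₀ η x, x ∈ Metric.ball x₀ 1 → ‖-deriv k (η - x) * φ η‖ ≤ bd x₀ η := by
    intro x₀ η x hx
    rw [Metric.mem_ball, Real.dist_eq] at hx
    rw [Real.norm_eq_abs, abs_mul, abs_neg]
    have h1 := (hb (η - x)).2
    have h2 : C * Real.exp (-(μ * |η - x|)) ≤ bd x₀ η := by
      simp only [bd]
      rw [mul_assoc, ← Real.exp_add]
      gcongr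
      have : |η - x₀| ≤ |η - x| + |x - x₀| := abs_sub_le _ _ _
      nlinarith
    calc _ ≤ |deriv k (η - x)| * 1 := by gcongr; exact hφ1 η
      _ ≤ _ := by linarith
  have hderiv : ∀ x₀, HasDerivAt (KK k φ) (∫ η, -deriv k (η - x₀) * φ η) x₀ := by
    intro x₀
    refine (hasDerivAt_integral_of_dominated_loc_of_deriv_le (μ := volume)
      (F := fun x η => k (η - x) * φ η)
      (F' := fun x η => -deriv k (η - x) * φ η) (bound := bd x₀)
      (Metric.ball_mem_nhds x₀ one_pos) (Eventually.of_forall fun x => (KK_int hk hφ x).1)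
      (KK_int hk hφ x₀) ?_ (Eventually.of_forall fun η x hx => hbound x₀ η x hx) (hbd x₀)
      (Eventually.of_forall fun η x hx => ?_)).2
    · exact (((hd.comp (continuous_id.sub continuous_const)).neg.measurable).mul
        hφ.1).aestronglyMeasurable
    · have h1 : HasDerivAt (fun x => η - x) (-1) x := by
        simpa using (hasDerivAt_id x).const_sub η
      have := ((hkd (η - x)).comp x h1).mul_const (φ η)
      simpa [Function.comp_def] using this
  rw [contDiff_one_iff_deriv]
  refine ⟨fun x => (hderiv x).differentiableAt, ?_⟩
  have : deriv (KK k φ) = fun x => ∫ η, -deriv k (η - x) * φ η := funext fun x => (hderiv x).deriv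
  rw [this, continuous_iff_continuousAt]
  intro x₀
  refine continuousAt_of_dominated (bound := bd x₀) (Eventually.of_forall fun x => ?_) ?_ (hbd x₀)
    (Eventually.of_forall fun η => ?_)
  · exact (((hd.comp (continuous_id.sub continuous_const)).neg.measurable).mul
        hφ.1).aestronglyMeasurable
  · filter_upwards [Metric.ball_mem_nhds x₀ one_pos] with x hx
    exact Eventually.of_forall fun η => hbound x₀ η x hx
  · have : Continuous fun x => -deriv k (η - x) * φ η := by fun_prop
    exact this.continuousAt

lemma KK_zero {k φ : ℝ → ℝ} (hk : H1 k) (hφ : Adm φ) (hc : Continuous φ) {x : ℝ}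
    (h : KK k φ x = 0) : ∀ᶠ y in 𝓝 x, φ y = 0 := by
  have hkc := hk.1.continuous
  have h1 : (fun η => k (η - x) * φ η) =ᵐ[volume] 0 :=
    (integral_eq_zero_iff_of_nonneg (fun z => mul_nonneg (hk.2.1 _) (hφ.2 z).1)
      (KK_int hk hφ x)).1 h
  have h2 : (fun η => k (η - x) * φ η) = 0 :=
    (Continuous.ae_eq_iff_eq volume (by fun_prop) continuous_zero).1 h1
  have h3 : ∀ᶠ y in 𝓝 x, 0 < k (y - x) := by
    have : ContinuousAt (fun y => k (y - x)) x := by fun_prop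
    exact this.eventually (lt_mem_nhds (by simpa using hk.2.2.2.2.1))
  filter_upwards [h3] with y hy
  have := congrFun h2 y
  simp only [Pi.zero_apply, mul_eq_zero] at this
  rcases this with h | h
  · exact absurd h hy.ne'
  · exact h

def GG (k : ℝ → ℝ) (r q : ℝ) (χ φ : ℝ → ℝ) (s : ℝ) : ℝ :=
  KK k φ s + ((1 + 2 * r + (r + q) * χ s) * φ s - r * χ s * φ s ^ 2)

def TT (k : ℝ → ℝ) (r q a : ℝ) (χ φ : ℝ → ℝ) (x : ℝ) : ℝ :=
  (1 / (2 + q + 2 * r)) * ∫ t in Ioi (0:ℝ), Real.exp (-t) * GG k r q χ φ (x + a * t)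

lemma gg_mono {r q X u w : ℝ} (hr : 0 < r) (hq : 0 < q) (hX : 0 ≤ X ∧ X ≤ 1)
    (h0 : 0 ≤ u) (huw : u ≤ w) (hw : w ≤ 1) :
    (1 + 2 * r + (r + q) * X) * u - r * X * u ^ 2 ≤
      (1 + 2 * r + (r + q) * X) * w - r * X * w ^ 2 := by
  have h1 : 0 ≤ 1 + 2 * r + (r + q) * X - r * X * (u + w) := by
    have : r * X * (u + w) ≤ r * 1 * (1 + 1) := by
      have := hX.1
      have := hX.2
      gcongr <;> linarith
    have : 0 ≤ (r + q) * X := mul_nonneg (by linarith) hX.1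
    linarith
  nlinarith [mul_nonneg (sub_nonneg.2 huw) h1]

section
variable {k : ℝ → ℝ} {r q : ℝ} {χ φ ψ : ℝ → ℝ}

lemma GG_mono (hk : H1 k) (hr : 0 < r) (hq : 0 < q) (hχ : Adm χ) (hφ : Adm φ) (hψ : Adm ψ)
    (h : ∀ x, φ x ≤ ψ x) (x : ℝ) : GG k r q χ φ x ≤ GG k r q χ ψ x :=
  add_le_add (KK_mono hk hφ hψ h x) (gg_mono hr hq (hχ.2 x) (hφ.2 x).1 (h x) (hψ.2 x).2)

lemma GG_ge (hr : 0 < r) (hq : 0 < q) (hχ : Adm χ) (hφ : Adm φ) (x : ℝ) :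
    KK k φ x ≤ GG k r q χ φ x := by
  have := gg_mono hr hq (hχ.2 x) le_rfl (hφ.2 x).1 (hφ.2 x).2
  simp only [GG]
  simp at this ⊢
  linarith

lemma GG_nonneg (hk : H1 k) (hr : 0 < r) (hq : 0 < q) (hχ : Adm χ) (hφ : Adm φ) (x : ℝ) :
    0 ≤ GG k r q χ φ x := (KK_nonneg hk hφ x).trans (GG_ge hr hq hχ hφ x)

lemma GG_le (hk : H1 k) (hr : 0 < r) (hq : 0 < q) (hχ : Adm χ) (hφ : Adm φ) (x : ℝ) :
    GG k r q χ φ x ≤ 2 + q + 2 * r := by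
  refine (GG_mono hk hr hq hχ hφ adm_one (fun x => (hφ.2 x).2) x).trans ?_
  simp only [GG, KK_one hk]
  nlinarith [hχ.2 x]

lemma GG_meas (hk : H1 k) (hχ : Adm χ) (hφ : Adm φ) : Measurable (GG k r q χ φ) := by
  have h1 : Measurable (KK k φ) := (KK_contDiff hk hφ).continuous.measurable
  have := hφ.1
  have := hχ.1
  unfold GG
  fun_prop

lemma TT_int (hk : H1 k) (hr : 0 < r) (hq : 0 < q) (hχ : Adm χ) (hφ : Adm φ) (a x : ℝ) :
    IntegrableOn (fun t => Real.exp (-t) * GG k r q χ φ (x + a * t)) (Ioi (0:ℝ)) := by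
  refine Integrable.mul_bdd (c := 2 + q + 2 * r) (integrableOn_exp_neg_Ioi 0) ?_
    (Eventually.of_forall fun z => ?_)
  · exact ((GG_meas hk hχ hφ).comp (by fun_prop)).aestronglyMeasurable
  · rw [Real.norm_eq_abs, abs_of_nonneg (GG_nonneg hk hr hq hχ hφ _)]
    exact GG_le hk hr hq hχ hφ _

lemma TT_mono (hk : H1 k) (hr : 0 < r) (hq : 0 < q) (hχ : Adm χ) (hφ : Adm φ) (hψ : Adm ψ)
    (h : ∀ x, φ x ≤ ψ x) (a x : ℝ) : TT k r q a χ φ x ≤ TT k r q a χ ψ x := by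
  unfold TT
  refine mul_le_mul_of_nonneg_left ?_ (by positivity)
  refine integral_mono (TT_int hk hr hq hχ hφ a x) (TT_int hk hr hq hχ hψ a x) (fun t => ?_)
  exact mul_le_mul_of_nonneg_left (GG_mono hk hr hq hχ hφ hψ h _) (Real.exp_pos _).le

lemma TT_adm (hk : H1 k) (hr : 0 < r) (hq : 0 < q) (hχ : Adm χ) (hφ : Adm φ) (a : ℝ) :
    Adm (TT k r q a χ φ) := by
  refine ⟨?_, fun x => ⟨?_, ?_⟩⟩
  · unfold TT
    refine Measurable.const_mul ?_ _
    have : Measurable (Function.uncurry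
        (fun x t => Real.exp (-t) * GG k r q χ φ (x + a * t))) := by
      have := GG_meas (r := r) (q := q) hk hχ hφ
      unfold Function.uncurry
      fun_prop
    exact (this.stronglyMeasurable.integral_prod_right).measurable
  · unfold TT
    refine mul_nonneg (by positivity) (integral_nonneg fun t => ?_)
    exact mul_nonneg (Real.exp_pos _).le (GG_nonneg hk hr hq hχ hφ _)
  · unfold TT
    have : ∫ t in Ioi (0:ℝ), Real.exp (-t) * GG k r q χ φ (x + a * t) ≤
        ∫ t in Ioi (0:ℝ), Real.exp (-t) * (2 + q + 2 * r) := by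
      refine integral_mono (TT_int hk hr hq hχ hφ a x)
        ((integrableOn_exp_neg_Ioi 0).mul_const _) (fun t => ?_)
      exact mul_le_mul_of_nonneg_left (GG_le hk hr hq hχ hφ _) (Real.exp_pos _).le
    rw [integral_mul_const, integral_exp_neg_Ioi_zero, one_mul] at this
    rw [one_div, inv_mul_le_iff₀ (by positivity)]
    linarith

/-- fixed point by monotone iteration -/
lemma TT_fixed (hk : H1 k) (hr : 0 < r) (hq : 0 < q) (hχ : Adm χ) (a : ℝ) {v : ℝ → ℝ}
    (hv : Adm v) (hsub : ∀ x, v x ≤ TT k r q a χ v x) :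
    ∃ Φ, Adm Φ ∧ (∀ x, v x ≤ Φ x) ∧ ∀ x, Φ x = TT k r q a χ Φ x := by
  let u : ℕ → ℝ → ℝ := fun n => (TT k r q a χ)^[n] (fun _ => 1)
  have u_succ : ∀ n, u (n + 1) = TT k r q a χ (u n) := fun n =>
    Function.iterate_succ_apply' _ _ _
  have u_adm : ∀ n, Adm (u n) := by
    intro n
    induction n with
    | zero => exact adm_one
    | succ n ih => rw [u_succ]; exact TT_adm hk hr hq hχ ih a
  have u_step : ∀ n x, u (n + 1) x ≤ u n x := by
    intro n
    induction n with
    | zero => intro x; exact ((u_adm 1).2 x).2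
    | succ n ih =>
      intro x
      rw [u_succ (n + 1)]
      conv_rhs => rw [u_succ n]
      exact TT_mono hk hr hq hχ (u_adm _) (u_adm _) ih a x
  have u_v : ∀ n x, v x ≤ u n x := by
    intro n
    induction n with
    | zero => intro x; exact (hv.2 x).2
    | succ n ih =>
      intro x
      rw [u_succ n]
      exact (hsub x).trans (TT_mono hk hr hq hχ hv (u_adm _) ih a x)
  have u_anti : ∀ x, Antitone (fun n => u n x) := fun x => antitone_nat_of_succ_le (u_step · x)
  have u_lim : ∀ x, Tendsto (fun n => u n x) atTop (𝓝 (⨅ n, u n x)) := fun x =>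
    tendsto_atTop_ciInf (u_anti x) ⟨0, by rintro _ ⟨n, rfl⟩; exact ((u_adm n).2 x).1⟩
  set Φ : ℝ → ℝ := fun x => ⨅ n, u n x with hΦ
  have hΦm : Measurable Φ := measurable_of_tendsto_metrizable (fun n => (u_adm n).1)
    (tendsto_pi_nhds.2 u_lim)
  have hΦa : Adm Φ := ⟨hΦm, fun x => ⟨ge_of_tendsto' (u_lim x) fun n => ((u_adm n).2 x).1,
    le_of_tendsto' (u_lim x) fun n => ((u_adm n).2 x).2⟩⟩
  refine ⟨Φ, hΦa, fun x => ge_of_tendsto' (u_lim x) fun n => u_v n x, fun x => ?_⟩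
  have hK : ∀ x, Tendsto (fun n => KK k (u n) x) atTop (𝓝 (KK k Φ x)) := by
    intro x
    refine tendsto_integral_of_dominated_convergence (fun η => k (η - x))
      (fun n => (KK_int hk (u_adm n) x).1) (hk.integrable.comp_sub_right x)
      (fun n => Eventually.of_forall fun η => ?_) (Eventually.of_forall fun η => ?_)
    · rw [Real.norm_eq_abs, abs_of_nonneg (mul_nonneg (hk.2.1 _) ((u_adm n).2 η).1)]
      exact mul_le_of_le_one_right (hk.2.1 _) ((u_adm n).2 η).2
    · exact (u_lim η).const_mul _
  have hG : ∀ x, Tendsto (fun n => GG k r q χ (u n) x) atTop (𝓝 (GG k r q χ Φ x)) := by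
    intro x
    exact (hK x).add (((u_lim x).const_mul _).sub (((u_lim x).pow 2).const_mul _))
  have hT : Tendsto (fun n => TT k r q a χ (u n) x) atTop (𝓝 (TT k r q a χ Φ x)) := by
    refine Tendsto.const_mul _ ?_
    refine tendsto_integral_of_dominated_convergence (fun t => Real.exp (-t) * (2 + q + 2 * r))
      (fun n => (TT_int hk hr hq hχ (u_adm n) a x).1)
      ((integrableOn_exp_neg_Ioi 0).mul_const _)
      (fun n => Eventually.of_forall fun η => ?_) (Eventually.of_forall fun η => ?_)
    · rw [Real.norm_eq_abs, abs_of_nonneg (mul_nonneg (Real.exp_pos _).le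
        (GG_nonneg hk hr hq hχ (u_adm n) _))]
      exact mul_le_mul_of_nonneg_left (GG_le hk hr hq hχ (u_adm n) _) (Real.exp_pos _).le
    · exact (hG _).const_mul _
  have h2 : Tendsto (fun n => u (n + 1) x) atTop (𝓝 (Φ x)) :=
    (tendsto_add_atTop_iff_nat (f := fun n => u n x) 1).2 (u_lim x)
  simp only [u_succ] at h2
  exact tendsto_nhds_unique h2 hT

/-- differential subsolutions are integral subsolutions -/
lemma sub_le_TT (hk : H1 k) (hr : 0 < r) (hq : 0 < q) (hχ : Adm χ) {c : ℝ} (hc : 0 ≤ c)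
    {v v' : ℝ → ℝ} (hv : Adm v) (hvc : Continuous v)
    (hd : ∀ x, HasDerivWithinAt v (v' x) (Ici x) x)
    (hsub : ∀ x, 0 ≤ c * v' x + (KK k v x - v x) + (-q + (r * (1 - v x) + q) * χ x) * v x)
    (x : ℝ) : v x ≤ TT k r q (c / (2 + q + 2 * r)) χ v x := by
  set β := 2 + q + 2 * r with hβ
  have hβ0 : 0 < β := by positivity
  set a := c / β with ha
  have ha0 : 0 ≤ a := by positivity
  have haβ : a * β = c := by rw [ha]; field_simp
  have hint := TT_int hk hr hq hχ hv a x
  have key : ∀ b, 0 ≤ b → v x - Real.exp (-b) * v (x + a * b) ≤ TT k r q a χ v x := by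
    intro b hb
    have h1 := intervalIntegral.sub_le_integral_of_hasDeriv_right_of_le
      (g := fun t => - (Real.exp (-t) * v (x + a * t)))
      (g' := fun t => Real.exp (-t) * v (x + a * t) - Real.exp (-t) * (v' (x + a * t) * a))
      (φ := fun t => (1 / β) * (Real.exp (-t) * GG k r q χ v (x + a * t)))
      hb (by fun_prop) ?_ ?_ ?_
    · simp only [neg_zero, Real.exp_zero, mul_zero, add_zero, one_mul] at h1
      rw [intervalIntegral.integral_const_mul, intervalIntegral.integral_of_le hb] at h1
      have h2 : ∫ t in Ioc 0 b, Real.exp (-t) * GG k r q χ v (x + a * t) ≤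
          ∫ t in Ioi 0, Real.exp (-t) * GG k r q χ v (x + a * t) := by
        refine setIntegral_mono_set hint (Eventually.of_forall fun t => ?_)
          (Ioc_subset_Ioi_self.eventuallyLE)
        exact mul_nonneg (Real.exp_pos _).le (GG_nonneg hk hr hq hχ hv _)
      have h3 := mul_le_mul_of_nonneg_left h2 (show 0 ≤ 1 / β by positivity)
      unfold TT
      rw [← hβ]
      linarith
    · intro t ht
      have e1 : HasDerivWithinAt (fun t : ℝ => x + a * t) a (Ici t) t := by
        simpa using (((hasDerivAt_id t).const_mul a).const_add x).hasDerivWithinAt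
      have e2 : HasDerivWithinAt (fun t => v (x + a * t)) (v' (x + a * t) * a) (Ici t) t := by
        refine (hd (x + a * t)).comp t e1 (fun s hs => ?_)
        simp only [mem_Ici] at hs ⊢
        gcongr
      have e3 : HasDerivWithinAt (fun t : ℝ => Real.exp (-t)) (-Real.exp (-t)) (Ici t) t := by
        simpa using ((hasDerivAt_id t).neg.exp).hasDerivWithinAt
      have e4 := (e3.mul e2).neg.mono (Ioi_subset_Ici_self)
      refine e4.congr_deriv ?_
      ring
    · refine Integrable.const_mul ?_ _
      exact ((integrableOn_Ici_iff_integrableOn_Ioi).2 hint).mono_set Icc_subset_Ici_self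
    · intro t ht
      have h := hsub (x + a * t)
      set y := x + a * t
      have : v y - v' y * a ≤ (1 / β) * GG k r q χ v y := by
        rw [one_div, le_inv_mul_iff₀ hβ0]
        simp only [GG]
        have : β * (v y - v' y * a) = β * v y - c * v' y := by rw [← haβ]; ring
        rw [this, hβ]
        nlinarith
      have := mul_le_mul_of_nonneg_left this (Real.exp_pos (-t)).le
      show _ - _ ≤ _
      linarith
  have hlim : Tendsto (fun b => v x - Real.exp (-b) * v (x + a * b)) atTop (𝓝 (v x - 0)) := by
    refine Tendsto.const_sub _ ?_
    refine squeeze_zero (fun b => mul_nonneg (Real.exp_pos _).le (hv.2 _).1)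
      (fun b => mul_le_of_le_one_right (Real.exp_pos _).le (hv.2 _).2) ?_
    exact Real.tendsto_exp_neg_atTop_nhds_zero
  rw [sub_zero] at hlim
  refine le_of_tendsto hlim ?_
  filter_upwards [eventually_ge_atTop 0] with b hb using key b hb

end

section
variable {k : ℝ → ℝ} {r q : ℝ} {χ Φ : ℝ → ℝ}

lemma KK_pos_all (hk : H1 k) (hΦ : Adm Φ) (hz : ∀ y, Φ y = 0 → KK k Φ y = 0) {x0 : ℝ}
    (h0 : 0 < KK k Φ x0) (x : ℝ) : 0 < KK k Φ x := by
  have hKc : Continuous (KK k Φ) := (KK_contDiff hk hΦ).continuous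
  have hkc := hk.1.continuous
  have hcl : IsClopen {x | KK k Φ x = 0} := by
    refine ⟨isClosed_eq hKc continuous_const, ?_⟩
    rw [isOpen_iff_mem_nhds]
    intro x hx
    have h1 : (fun η => k (η - x) * Φ η) =ᵐ[volume] 0 :=
      (integral_eq_zero_iff_of_nonneg (fun z => mul_nonneg (hk.2.1 _) (hΦ.2 z).1)
        (KK_int hk hΦ x)).1 hx
    have hU : IsOpen {y | 0 < k (y - x)} := isOpen_lt continuous_const (by fun_prop)
    have hV : IsOpen {y | KK k Φ y ≠ 0} := isOpen_ne_fun hKc continuous_const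
    have hUV : volume ({y | 0 < k (y - x)} ∩ {y | KK k Φ y ≠ 0}) = 0 := by
      refine measure_mono_null ?_ h1
      rintro y ⟨hy1, hy2⟩
      simp only [mem_ofPred_eq] at hy1 hy2
      intro hy
      simp only [mem_ofPred_eq, Pi.zero_apply, mul_eq_zero] at hy
      rcases hy with hy | hy
      · exact hy1.ne' hy
      · exact hy2 (hz y hy)
    have hE := (hU.inter hV).measure_eq_zero_iff volume |>.1 hUV
    refine mem_of_superset (hU.mem_nhds (by simpa using hk.2.2.2.2.1)) (fun y hy => ?_)
    by_contra hne
    have : y ∈ ({y | 0 < k (y - x)} ∩ {y | KK k Φ y ≠ 0}) := ⟨hy, hne⟩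
    rw [hE] at this
    exact this
  rcases isClopen_iff.1 hcl with h | h
  · refine lt_of_le_of_ne (KK_nonneg hk hΦ x) (fun hx => ?_)
    have : x ∈ {x | KK k Φ x = 0} := hx.symm
    rw [h] at this
    exact this
  · have : x0 ∈ {x | KK k Φ x = 0} := by rw [h]; trivial
    exact absurd this h0.ne'

lemma setIntegral_shift (h : ℝ → ℝ) (x : ℝ) :
    ∫ y in Ioi (0:ℝ), h (x + y) = ∫ y in Ioi x, h y := by
  have := (measurePreserving_add_left (volume : Measure ℝ) x).setIntegral_preimage_emb
    (measurableEmbedding_addLeft x) h (Ioi x)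
  simpa using this

lemma fixed_TW_pos (hk : H1 k) (hr : 0 < r) (hq : 0 < q) (hχ : Adm χ) (hχc : ContDiff ℝ 1 χ)
    {c : ℝ} (hc : 0 < c) (hΦ : Adm Φ)
    (hfix : ∀ x, Φ x = TT k r q (c / (2 + q + 2 * r)) χ Φ x) :
    ContDiff ℝ 1 Φ ∧
    ∀ ξ, c * deriv Φ ξ + (KK k Φ ξ - Φ ξ) + (-q + (r * (1 - Φ ξ) + q) * χ ξ) * Φ ξ = 0 := by
  set β := 2 + q + 2 * r with hβ
  have hβ0 : 0 < β := by positivity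
  set a := c / β with ha
  have ha0 : 0 < a := by positivity
  have haβ : a * β = c := by rw [ha]; field_simp
  let G := GG k r q χ Φ
  let h : ℝ → ℝ := fun s => Real.exp ((-1 / a) * s) * G s
  have hhint : ∀ x, IntegrableOn h (Ioi x) := by
    intro x
    refine Integrable.mul_bdd (c := β)
      (integrableOn_exp_mul_Ioi (div_neg_of_neg_of_pos (by norm_num) ha0) x)
      (GG_meas hk hχ hΦ).aestronglyMeasurable (Eventually.of_forall fun z => ?_)
    rw [Real.norm_eq_abs, abs_of_nonneg (GG_nonneg hk hr hq hχ hΦ _)]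
    exact GG_le hk hr hq hχ hΦ _
  have hrep : ∀ x, Φ x = (1 / c) * (Real.exp (x / a) *
      ((∫ s in Ioi (0:ℝ), h s) - ∫ s in (0:ℝ)..x, h s)) := by
    intro x
    have e1 : (∫ s in Ioi (0:ℝ), h s) - ∫ s in (0:ℝ)..x, h s = ∫ s in Ioi x, h s := by
      rw [← intervalIntegral.integral_Ioi_sub_Ioi' (hhint 0) (hhint x)]; ring
    rw [e1, hfix x, TT, ← hβ, ← setIntegral_shift h x]
    have e2 := integral_comp_mul_left_Ioi (fun y => h (x + y)) 0 ha0
    rw [mul_zero, smul_eq_mul] at e2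
    have e3 : ∫ y in Ioi (0:ℝ), h (x + y) = a * ∫ t in Ioi (0:ℝ), h (x + a * t) := by
      rw [e2]; field_simp
    have e5 : Real.exp (x / a) * ∫ t in Ioi (0:ℝ), h (x + a * t) =
        ∫ t in Ioi (0:ℝ), Real.exp (x / a) * h (x + a * t) := (integral_const_mul _ _).symm
    rw [e3, mul_left_comm (Real.exp _) a, e5, ← mul_assoc]
    have e4 : 1 / c * a = 1 / β := by rw [← haβ]; field_simp
    rw [e4]
    congr 1
    refine integral_congr_ae (Eventually.of_forall fun t => ?_)
    simp only [h, G]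
    rw [← mul_assoc, ← Real.exp_add]
    congr 2
    field_simp
    ring
  have hΦc : Continuous Φ := by
    rw [funext hrep]
    have : Continuous fun b => ∫ s in (0:ℝ)..b, h s := by
      refine intervalIntegral.continuous_primitive (fun a b => ?_) 0
      rw [intervalIntegrable_iff]
      exact (hhint (min a b)).mono_set (fun y hy => hy.1)
    fun_prop
  have hGc : Continuous G := by
    have := (KK_contDiff hk hΦ).continuous
    have := hχc.continuous
    show Continuous (GG k r q χ Φ)
    unfold GG
    fun_prop
  have hhc : Continuous h := by fun_prop
  have hder : ∀ x, HasDerivAt Φ ((β * Φ x - G x) / c) x := by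
    intro x
    have d1 : HasDerivAt (fun b => ∫ s in (0:ℝ)..b, h s) (h x) x :=
      (hhc.integral_hasStrictDerivAt 0 x).hasDerivAt
    have d2 : HasDerivAt (fun x : ℝ => Real.exp (x / a)) (Real.exp (x / a) * (1 / a)) x :=
      ((hasDerivAt_id x).div_const a).exp
    have d3 := (d2.mul (d1.const_sub (∫ s in Ioi (0:ℝ), h s))).const_mul (1 / c)
    have d4 : HasDerivAt Φ _ x := d3.congr_of_eventuallyEq (Eventually.of_forall hrep)
    refine d4.congr_deriv ?_
    have e5 : Real.exp (x / a) * h x = G x := by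
      simp only [h]
      rw [← mul_assoc, ← Real.exp_add]
      have : x / a + -1 / a * x = 0 := by field_simp; ring
      rw [this, Real.exp_zero, one_mul]
    have e6 : β / c = (1 / c) * (1 / a) * c := by rw [← haβ]; field_simp
    have e7 := hrep x
    rw [mul_add, sub_div, mul_div_right_comm, e6]
    conv_rhs => rw [e7]
    rw [mul_neg, e5]
    field_simp
    ring
  refine ⟨?_, fun ξ => ?_⟩
  · rw [contDiff_one_iff_deriv]
    refine ⟨fun x => (hder x).differentiableAt, ?_⟩
    rw [funext fun x => (hder x).deriv]
    fun_prop
  · rw [(hder ξ).deriv, mul_div_cancel₀ _ hc.ne']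
    simp only [G, GG, hβ]
    ring

lemma fixed_TW_zero (hr : 0 < r) (hq : 0 < q)
    (hfix : ∀ x, Φ x = TT k r q 0 χ Φ x) (ξ : ℝ) :
    (KK k Φ ξ - Φ ξ) + (-q + (r * (1 - Φ ξ) + q) * χ ξ) * Φ ξ = 0 := by
  have h := hfix ξ
  rw [TT] at h
  simp only [zero_mul, add_zero] at h
  rw [integral_mul_const, integral_exp_neg_Ioi_zero, one_mul, one_div,
    eq_inv_mul_iff_mul_eq₀ (by positivity), GG] at h
  linarith

lemma quad_contDiff {A B m : ℝ → ℝ} (hA : ContDiff ℝ 1 A) (hB : ContDiff ℝ 1 B)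
    (hm : ContDiff ℝ 1 m) (hm0 : ∀ x, 0 < m x) (hA0 : ∀ x, 0 ≤ A x) (hΦ0 : ∀ x, 0 < Φ x)
    (heq : ∀ x, A x * Φ x ^ 2 + B x * Φ x = m x) : ContDiff ℝ 1 Φ := by
  have h1 : ∀ x, 0 < A x * Φ x + B x := by
    intro x
    have : 0 < (A x * Φ x + B x) * Φ x := by have := hm0 x; rw [← heq] at this; nlinarith
    exact pos_of_mul_pos_left this (hΦ0 x).le
  have h2 : ∀ x, 0 < 2 * A x * Φ x + B x := fun x => by
    nlinarith [h1 x, mul_nonneg (hA0 x) (hΦ0 x).le]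
  have h3 : ∀ x, B x ^ 2 + 4 * A x * m x = (2 * A x * Φ x + B x) ^ 2 := fun x => by
    rw [← heq]; ring
  have h4 : ∀ x, √(B x ^ 2 + 4 * A x * m x) = 2 * A x * Φ x + B x := fun x => by
    rw [h3, Real.sqrt_sq (h2 x).le]
  have h5 : ∀ x, Φ x = 2 * m x / (B x + √(B x ^ 2 + 4 * A x * m x)) := by
    intro x
    rw [h4, eq_div_iff (by nlinarith [h1 x]), ← heq]
    ring
  rw [funext h5]
  refine ContDiff.div (by fun_prop) ?_ (fun x => ?_)
  · refine hB.add (ContDiff.sqrt (by fun_prop) (fun x => ?_))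
    rw [h3]; exact pow_ne_zero _ (h2 x).ne'
  · rw [h4]; nlinarith [h1 x]

/-- Existence from a subsolution. -/
lemma exists_TW (hk : H1 k) (hr : 0 < r) (hq : 0 < q) (hχ : Adm χ) (hχc : ContDiff ℝ 1 χ)
    {c : ℝ} (hc : 0 ≤ c)
    {v v' : ℝ → ℝ} (hv : Adm v) (hvc : Continuous v)
    (hd : ∀ x, HasDerivWithinAt v (v' x) (Ici x) x)
    (hsub : ∀ x, 0 ≤ c * v' x + (KK k v x - v x) + (-q + (r * (1 - v x) + q) * χ x) * v x)
    {x0 : ℝ} (hx0 : 0 < v x0) :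
    ∃ Φ, IsTW c k (fun x u => -q + (r * (1 - u) + q) * χ x) Φ := by
  obtain ⟨Φ, hΦ, hvΦ, hfix⟩ := TT_fixed hk hr hq hχ _ hv (sub_le_TT hk hr hq hχ hc hv hvc hd hsub)
  have hK0 : 0 < KK k Φ x0 := by
    refine lt_of_lt_of_le ?_ (KK_mono hk hv hΦ hvΦ x0)
    refine lt_of_le_of_ne (KK_nonneg hk hv x0) (fun h => ?_)
    exact hx0.ne' (KK_zero hk hv hvc h.symm).self_of_nhds
  rcases hc.eq_or_lt with rfl | hc
  · rw [zero_div] at hfix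
    have heq := fixed_TW_zero hr hq hfix
    have hKp := KK_pos_all hk hΦ (fun y hy => by have := heq y; rw [hy] at this; simpa using this) hK0
    have hp : ∀ x, 0 < Φ x := fun x => lt_of_le_of_ne (hΦ.2 x).1 (fun h => by
      have := heq x; rw [← h] at this; simp at this; exact (hKp x).ne' this)
    refine ⟨Φ, ?_, hp, ⟨1, fun x => (hΦ.2 x).2⟩, fun ξ => ?_⟩
    · refine quad_contDiff (A := fun x => r * χ x) (B := fun x => 1 + q - (r + q) * χ x)
        (m := KK k Φ) (by fun_prop) (by fun_prop) (KK_contDiff hk hΦ) hKp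
        (fun x => mul_nonneg hr.le (hχ.2 x).1) hp (fun x => ?_)
      have := heq x
      linarith
    · have := heq ξ
      unfold KK at this
      linarith
  · obtain ⟨hC, heq⟩ := fixed_TW_pos hk hr hq hχ hχc hc hΦ hfix
    have hz : ∀ y, Φ y = 0 → deriv Φ y = 0 := fun y hy => by
      refine IsLocalMin.deriv_eq_zero (Eventually.of_forall fun z => ?_)
      rw [hy]; exact (hΦ.2 z).1
    have hzK : ∀ y, Φ y = 0 → KK k Φ y = 0 := fun y hy => by
      have := heq y; rw [hz y hy, hy] at this; simpa using this
    have hKp := KK_pos_all hk hΦ hzK hK0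
    exact ⟨Φ, hC, fun x => lt_of_le_of_ne (hΦ.2 x).1 (fun h => (hKp x).ne' (hzK x h.symm)),
      ⟨1, fun x => (hΦ.2 x).2⟩, heq⟩

end

set_option maxHeartbeats 1000000 in
lemma bump_est {κ : ℝ → ℝ} (hκc : Continuous κ) (hκ0 : ∀ z, 0 ≤ κ z) (hκp : 0 < κ 0)
    (i0 : Integrable κ) (i1 : Integrable fun z => z * κ z) (i2 : Integrable fun z => z ^ 2 * κ z)
    {lam : ℝ} (hlam : 0 < lam) :
    ∃ R, 0 < R ∧ ∀ x, |x| ≤ R →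
      (∫ z, κ z) * (1 - x ^ 2 / R ^ 2) + (∫ z, z * κ z) * (-2 * x / R ^ 2)
        - lam * (1 - x ^ 2 / R ^ 2) ≤ ∫ z, κ z * max (1 - (z + x) ^ 2 / R ^ 2) 0 := by
  obtain ⟨d0, hd0, hball⟩ := Metric.mem_nhds_iff.1
    (hκc.continuousAt.eventually (lt_mem_nhds (half_lt_self hκp)))
  set p := κ 0 / 2 with hp
  have hp0 : 0 < p := by positivity
  set d := d0 / 2 with hd
  have hd1 : 0 < d := by positivity
  have hpd : ∀ z, |z| ≤ d → p ≤ κ z := fun z hz => by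
    have : z ∈ Metric.ball (0:ℝ) d0 := by
      rw [mem_ball_zero_iff, Real.norm_eq_abs]; linarith
    exact (show p < κ z from hball this).le
  set m2 := ∫ z, z ^ 2 * κ z with hm2
  have hm20 : 0 ≤ m2 := integral_nonneg fun z => mul_nonneg (sq_nonneg z) (hκ0 z)
  set R := 4 * m2 / (p * d ^ 2) + 4 * m2 / (lam * d) + d + 1 with hR
  have hA : 0 ≤ 4 * m2 / (p * d ^ 2) := by positivity
  have hB : 0 ≤ 4 * m2 / (lam * d) := by positivity
  have hR0 : 0 < R := by linarith
  have hRd : d ≤ R := by linarith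
  have hRA : m2 / R ^ 2 ≤ p * (d / 2) * (d / (2 * R)) := by
    have : 4 * m2 ≤ R * (p * d ^ 2) := by
      rw [← div_le_iff₀ (by positivity)]; linarith
    rw [div_le_iff₀ (by positivity)]
    have e : p * (d / 2) * (d / (2 * R)) * R ^ 2 = R * (p * d ^ 2) / 4 := by field_simp; ring
    rw [e]; linarith
  have hRB : m2 / R ^ 2 ≤ lam * (d / (4 * R)) := by
    have : 4 * m2 ≤ R * (lam * d) := by
      rw [← div_le_iff₀ (by positivity)]; linarith
    rw [div_le_iff₀ (by positivity)]
    have e : lam * (d / (4 * R)) * R ^ 2 = R * (lam * d) / 4 := by field_simp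
    rw [e]; linarith
  refine ⟨R, hR0, fun x hx => ?_⟩
  clear_value R m2 d p
  have hxR : x ^ 2 ≤ R ^ 2 := by rw [← sq_abs x]; gcongr
  have hP0 : 0 ≤ 1 - x ^ 2 / R ^ 2 := by
    rw [sub_nonneg, div_le_one (by positivity)]; exact hxR
  -- polynomial part
  have ipoly : Integrable fun z => κ z * (1 - (z + x) ^ 2 / R ^ 2) := by
    have := ((i0.const_mul (1 - x ^ 2 / R ^ 2)).add (i1.const_mul (-2 * x / R ^ 2))).add
      (i2.const_mul (-1 / R ^ 2))
    refine this.congr (Eventually.of_forall fun z => ?_)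
    simp only [Pi.add_apply]
    field_simp
    ring
  have epoly : ∫ z, κ z * (1 - (z + x) ^ 2 / R ^ 2) =
      (∫ z, κ z) * (1 - x ^ 2 / R ^ 2) + (∫ z, z * κ z) * (-2 * x / R ^ 2) - m2 / R ^ 2 := by
    have e : (fun z => κ z * (1 - (z + x) ^ 2 / R ^ 2)) = fun z =>
        ((1 - x ^ 2 / R ^ 2) * κ z + (-2 * x / R ^ 2) * (z * κ z)) + (-1 / R ^ 2) * (z ^ 2 * κ z) := by
      funext z
      field_simp
      ring
    have i01 : Integrable fun z => (1 - x ^ 2 / R ^ 2) * κ z + (-2 * x / R ^ 2) * (z * κ z) :=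
      (i0.const_mul _).add (i1.const_mul _)
    rw [e, integral_add i01 (i2.const_mul _),
      integral_add (i0.const_mul _) (i1.const_mul _), integral_const_mul, integral_const_mul,
      integral_const_mul, ← hm2]
    ring
  have imax : Integrable fun z => κ z * max (1 - (z + x) ^ 2 / R ^ 2) 0 := by
    refine i0.mul_bdd (c := 1) ?_ (Eventually.of_forall fun z => ?_)
    · exact Continuous.aestronglyMeasurable (by fun_prop)
    · rw [Real.norm_eq_abs, abs_of_nonneg (le_max_right _ _)]
      refine max_le ?_ zero_le_one
      have : 0 ≤ (z + x) ^ 2 / R ^ 2 := by positivity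
      linarith
  by_cases hnear : |x| ≤ R - d / 4
  · have h1 : ∫ z, κ z * (1 - (z + x) ^ 2 / R ^ 2) ≤
        ∫ z, κ z * max (1 - (z + x) ^ 2 / R ^ 2) 0 :=
      integral_mono ipoly imax fun z => mul_le_mul_of_nonneg_left (le_max_left _ _) (hκ0 z)
    have h2 : d / (4 * R) ≤ 1 - x ^ 2 / R ^ 2 := by
      have : x ^ 2 ≤ R ^ 2 - R * d / 4 := by
        rw [← sq_abs x]
        have := abs_nonneg x
        nlinarith
      have e : 1 - x ^ 2 / R ^ 2 - d / (4 * R) = (R ^ 2 - R * d / 4 - x ^ 2) / R ^ 2 := by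
        field_simp
        ring
      have : 0 ≤ (R ^ 2 - R * d / 4 - x ^ 2) / R ^ 2 := div_nonneg (by linarith) (by positivity)
      linarith
    have h3 := mul_le_mul_of_nonneg_left h2 hlam.le
    linarith
  · push Not at hnear
    have main : ∀ I : Set ℝ, MeasurableSet I → (∀ z ∈ I, |z| ≤ d) → volume.real I = d / 2 →
        volume I ≠ ⊤ →
        (∀ z ∈ I, d / (2 * R) ≤ (z + x) ^ 2 / R ^ 2 - 1) →
        p * (d / 2) * (d / (2 * R)) + ∫ z, κ z * (1 - (z + x) ^ 2 / R ^ 2) ≤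
          ∫ z, κ z * max (1 - (z + x) ^ 2 / R ^ 2) 0 := by
      intro I hI hId hvol hfin hIz
      have h1 : ∫ z, I.indicator (fun _ => p * (d / (2 * R))) z = p * (d / 2) * (d / (2 * R)) := by
        rw [integral_indicator hI, setIntegral_const, hvol, smul_eq_mul]; ring
      have iind : Integrable (I.indicator (fun _ : ℝ => p * (d / (2 * R)))) :=
        (integrable_indicator_iff hI).2 (integrableOn_const hfin)
      rw [← h1, ← integral_add iind ipoly]
      refine integral_mono (iind.add ipoly) imax fun z => ?_
      simp only []
      by_cases hz : z ∈ I
      · rw [indicator_of_mem hz]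
        have h2 := hIz z hz
        have h3 := hpd z (hId z hz)
        have h4 : 0 ≤ d / (2 * R) := by positivity
        rw [max_eq_right (by linarith)]
        nlinarith
      · rw [indicator_of_notMem hz, zero_add]
        exact mul_le_mul_of_nonneg_left (le_max_left _ _) (hκ0 z)
    have hfar : ∀ y, R + d / 4 ≤ |y| → d / (2 * R) ≤ y ^ 2 / R ^ 2 - 1 := by
      intro y hy
      have : R ^ 2 + R * d / 2 ≤ y ^ 2 := by
        rw [← sq_abs y]
        nlinarith
      have e : y ^ 2 / R ^ 2 - 1 - d / (2 * R) = (y ^ 2 - (R ^ 2 + R * d / 2)) / R ^ 2 := by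
        field_simp
        ring
      have : 0 ≤ (y ^ 2 - (R ^ 2 + R * d / 2)) / R ^ 2 := div_nonneg (by linarith) (by positivity)
      linarith
    have hgain : p * (d / 2) * (d / (2 * R)) + ∫ z, κ z * (1 - (z + x) ^ 2 / R ^ 2) ≤
          ∫ z, κ z * max (1 - (z + x) ^ 2 / R ^ 2) 0 := by
      rcases le_total 0 x with h0 | h0
      · rw [abs_of_nonneg h0] at hnear
        refine main (Icc (d / 2) d) measurableSet_Icc (fun z hz => ?_) ?_ (by simp) (fun z hz => ?_)
        · rw [abs_of_nonneg (by linarith [hz.1])]; exact hz.2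
        · rw [Real.volume_real_Icc_of_le (by linarith)]; ring
        · apply hfar
          rw [abs_of_nonneg (by linarith [hz.1])]
          linarith [hz.1]
      · rw [abs_of_nonpos h0] at hnear
        refine main (Icc (-d) (-(d / 2))) measurableSet_Icc (fun z hz => ?_) ?_ (by simp)
          (fun z hz => ?_)
        · rw [abs_of_nonpos (by linarith [hz.2])]; linarith [hz.1]
        · rw [Real.volume_real_Icc_of_le (by linarith)]; ring
        · apply hfar
          rw [abs_of_nonpos (by linarith [hz.2])]
          linarith [hz.2]
    have := mul_nonneg hlam.le hP0
    linarith

lemma mom_int {k : ℝ → ℝ} (hk : H1 k) (hexp : EXPk k) (a : ℝ) :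
    Integrable (fun z => z * (Real.exp (a * z) * k z)) ∧
    Integrable (fun z => z ^ 2 * (Real.exp (a * z) * k z)) := by
  have hkc := hk.1.continuous
  have hI : Integrable fun z => 2 * (Real.exp ((a + 1) * z) * k z + Real.exp ((a - 1) * z) * k z) :=
    ((hexp (a + 1)).add (hexp (a - 1))).const_mul 2
  have hE : ∀ z, 2 * (Real.exp ((a + 1) * z) * k z + Real.exp ((a - 1) * z) * k z) =
      2 * (Real.exp z + Real.exp (-z)) * (Real.exp (a * z) * k z) := by
    intro z
    rw [show (a + 1) * z = a * z + z by ring, show (a - 1) * z = a * z + -z by ring,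
      Real.exp_add, Real.exp_add]
    ring
  have hb : ∀ z : ℝ, |z| ≤ 2 * (Real.exp z + Real.exp (-z)) ∧
      z ^ 2 ≤ 2 * (Real.exp z + Real.exp (-z)) := by
    intro z
    have h1 : Real.exp |z| ≤ Real.exp z + Real.exp (-z) := by
      rcases abs_cases z with ⟨h, -⟩ | ⟨h, -⟩ <;> rw [h] <;>
        linarith [Real.exp_pos z, Real.exp_pos (-z)]
    have h2 := Real.quadratic_le_exp_of_nonneg (abs_nonneg z)
    have h3 := sq_abs z
    have h4 := abs_nonneg z
    constructor <;> nlinarith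
  constructor
  · refine hI.mono' (Continuous.aestronglyMeasurable (by fun_prop)) (Eventually.of_forall fun z => ?_)
    have h0 : 0 ≤ Real.exp (a * z) * k z := mul_nonneg (Real.exp_pos _).le (hk.2.1 z)
    rw [hE, Real.norm_eq_abs, abs_mul, abs_of_nonneg h0]
    exact mul_le_mul_of_nonneg_right (hb z).1 h0
  · refine hI.mono' (Continuous.aestronglyMeasurable (by fun_prop)) (Eventually.of_forall fun z => ?_)
    have h0 : 0 ≤ Real.exp (a * z) * k z := mul_nonneg (Real.exp_pos _).le (hk.2.1 z)
    rw [hE, Real.norm_eq_abs, abs_mul, abs_of_nonneg h0, abs_of_nonneg (sq_nonneg z)]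
    exact mul_le_mul_of_nonneg_right (hb z).2 h0

lemma hasDerivAt_mom {k : ℝ → ℝ} (hk : H1 k) (hexp : EXPk k) (a : ℝ) :
    HasDerivAt (fun a => ∫ z, Real.exp (a * z) * k z) (∫ z, z * (Real.exp (a * z) * k z)) a := by
  have hm : Measurable fun z => (k z).toNNReal := hk.1.continuous.measurable.real_toNNReal
  let ν : Measure ℝ := volume.withDensity (fun z => ((k z).toNNReal : ENNReal))
  have hset : ProbabilityTheory.integrableExpSet (fun z : ℝ => z) ν = univ := by
    rw [eq_univ_iff_forall]
    intro t
    show Integrable _ _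
    rw [integrable_withDensity_iff_integrable_smul hm]
    refine (hexp t).congr (Eventually.of_forall fun z => ?_)
    simp only [NNReal.smul_def, Real.coe_toNNReal _ (hk.2.1 z), smul_eq_mul]
    ring
  have h := ProbabilityTheory.hasDerivAt_mgf (X := fun z : ℝ => z) (μ := ν) (t := a)
    (by rw [hset]; simp)
  have hint : ∀ g : ℝ → ℝ, ∫ z, g z ∂ν = ∫ z, k z * g z := by
    intro g
    rw [integral_withDensity_eq_integral_smul hm]
    refine integral_congr_ae (Eventually.of_forall fun z => ?_)
    simp only [NNReal.smul_def, Real.coe_toNNReal _ (hk.2.1 z), smul_eq_mul]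
  have e1 : ProbabilityTheory.mgf (fun z : ℝ => z) ν = fun a => ∫ z, Real.exp (a * z) * k z := by
    funext t
    rw [ProbabilityTheory.mgf, hint]
    simp only [mul_comm]
  rw [e1, hint] at h
  refine h.congr_deriv ?_
  refine integral_congr_ae (Eventually.of_forall fun z => ?_)
  simp only []
  ring

lemma disp {k : ℝ → ℝ} (hk : H1 k) (hexp : EXPk k) {r c : ℝ} (hr : 0 < r)
    (hc0 : 0 ≤ c) (hc : c < cstar k r) :
    ∃ a, (∫ z, z * (Real.exp (a * z) * k z)) = -c ∧
      0 < (∫ z, Real.exp (a * z) * k z) + c * a - 1 + r := by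
  have hkc := hk.1.continuous
  set M : ℝ → ℝ := fun a => ∫ z, Real.exp (a * z) * k z with hM
  have hMd : ∀ a, HasDerivAt M (∫ z, z * (Real.exp (a * z) * k z)) a := hasDerivAt_mom hk hexp
  have hMc : Continuous M := continuous_iff_continuousAt.2 fun a => (hMd a).continuousAt
  have hMsymm : ∀ a, M (-a) = M a := by
    intro a
    simp only [hM]
    rw [← integral_neg_eq_self]
    simp only [hk.2.2.1, neg_mul_neg]
  have i2 : Integrable fun z => z ^ 2 * k z := by simpa using (mom_int hk hexp 0).2
  set s := ∫ z, z ^ 2 * k z with hs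
  have hs0 : 0 < s := by
    obtain ⟨y, hy, hy0⟩ : ∃ y, 0 < k y ∧ y ≠ 0 := by
      have h1 : ∀ᶠ y in 𝓝[≠] (0:ℝ), 0 < k y :=
        (hkc.continuousAt.eventually (lt_mem_nhds hk.2.2.2.2.1)).filter_mono nhdsWithin_le_nhds
      exact (h1.and self_mem_nhdsWithin).exists
    refine integral_pos_of_integrable_nonneg_nonzero (x := y) (by fun_prop) i2
      (fun z => mul_nonneg (sq_nonneg z) (hk.2.1 z)) ?_
    exact mul_ne_zero (pow_ne_zero _ hy0) hy.ne'
  have hlow : ∀ a, 1 + a ^ 2 * s / 4 ≤ M a := by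
    intro a
    have h1 : M a + M (-a) = ∫ z, (Real.exp (a * z) * k z + Real.exp (-a * z) * k z) :=
      (integral_add (hexp a) (hexp (-a))).symm
    have h2 : ∫ z, (2 * k z + a ^ 2 / 2 * (z ^ 2 * k z)) = 2 + a ^ 2 / 2 * s := by
      rw [integral_add (hk.integrable.const_mul _) (i2.const_mul _), integral_const_mul,
        integral_const_mul, hk.2.2.2.1]
      ring
    have hx : ∀ x : ℝ, 2 + x ^ 2 / 2 ≤ Real.exp x + Real.exp (-x) := by
      intro x
      rcases le_total 0 x with h | h
      · linarith [Real.quadratic_le_exp_of_nonneg h, Real.add_one_le_exp (-x)]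
      · have := Real.quadratic_le_exp_of_nonneg (neg_nonneg.2 h)
        have e : (-x) ^ 2 = x ^ 2 := by ring
        linarith [Real.add_one_le_exp x]
    have h3 : ∫ z, (2 * k z + a ^ 2 / 2 * (z ^ 2 * k z)) ≤
        ∫ z, (Real.exp (a * z) * k z + Real.exp (-a * z) * k z) := by
      refine integral_mono ((hk.integrable.const_mul _).add (i2.const_mul _))
        ((hexp a).add (hexp (-a))) fun z => ?_
      have := mul_le_mul_of_nonneg_right (hx (a * z)) (hk.2.1 z)
      simp only [neg_mul]
      nlinarith
    rw [h2, ← h1, hMsymm] at h3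
    linarith
  have hM0 : M 0 = 1 := by simp [hM, hk.2.2.2.1]
  let E : ℝ → ℝ := fun a => M a + c * a - 1 + r
  have hEc : Continuous E := by fun_prop
  set B := 4 * c / s + 1 with hB
  have hB0 : 0 ≤ 4 * c / s := by positivity
  obtain ⟨a, haB, hamin⟩ := (isCompact_Icc (a := -B) (b := B)).exists_isMinOn
    ⟨0, by constructor <;> linarith⟩ hEc.continuousOn
  have hglob : ∀ b, E a ≤ E b := by
    intro b
    by_cases hb : b ∈ Icc (-B) B
    · exact hamin hb
    · have h0 : E a ≤ E 0 := hamin (by constructor <;> linarith)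
      refine h0.trans ?_
      simp only [E, hM0]
      have := hlow b
      have h5 : 0 ≤ b * (4 * c + b * s) := by
        rcases le_total 0 b with h | h
        · positivity
        · have h6 : b < -B := by
            by_contra hh
            exact hb ⟨not_lt.1 hh, by linarith⟩
          have h7 : 4 * c + b * s ≤ 0 := by
            have : 4 * c / s ≤ -b := by linarith
            rw [div_le_iff₀ hs0] at this
            linarith
          exact mul_nonneg_of_nonpos_of_nonpos h h7
      nlinarith
  have hEd : HasDerivAt E ((∫ z, z * (Real.exp (a * z) * k z)) + c) a := by
    have h1 : HasDerivAt (fun a : ℝ => c * a) c a := by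
      simpa using (hasDerivAt_id a).const_mul c
    exact (((hMd a).add h1).sub_const 1).add_const r
  have hE0 : (∫ z, z * (Real.exp (a * z) * k z)) + c = 0 :=
    IsLocalMin.hasDerivAt_eq_zero (Eventually.of_forall hglob) hEd
  refine ⟨a, by linarith, ?_⟩
  rcases le_or_gt 0 a with h | h
  · have := hlow a
    have h1 : 0 ≤ a ^ 2 * s / 4 := by positivity
    have h2 : 0 ≤ c * a := by positivity
    simp only [hM] at this
    linarith
  · have hbdd : BddBelow {y : ℝ | ∃ μ : ℝ, 0 < μ ∧
        y = ((∫ z, Real.exp (-(μ * z)) * k z) - 1 + r) / μ} := by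
      by_contra hn
      rw [cstar, Real.sInf_of_not_bddBelow hn] at hc
      linarith
    have h1 := hc.trans_le (csInf_le hbdd ⟨-a, neg_pos.2 h, rfl⟩)
    rw [lt_div_iff₀ (neg_pos.2 h)] at h1
    simp only [neg_mul, neg_neg] at h1
    linarith

set_option maxHeartbeats 1000000 in
lemma base_sub {k : ℝ → ℝ} (hk : H1 k) (hexp : EXPk k) {r q c : ℝ} (hr : 0 < r)
    (hc0 : 0 ≤ c) (hc : c < cstar k r) :
    ∃ R, 0 < R ∧ ∀ χ : ℝ → ℝ, (∀ x, |x| ≤ R → χ x = 1) →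
      ∃ v v' : ℝ → ℝ, Adm v ∧ Continuous v ∧ (∀ x, HasDerivWithinAt v (v' x) (Ici x) x) ∧
        (∀ x, 0 ≤ c * v' x + (KK k v x - v x) + (-q + (r * (1 - v x) + q) * χ x) * v x) ∧
        0 < v 0 := by
  obtain ⟨a, ha, hlam⟩ := disp hk hexp hr hc0 hc
  have hkc := hk.1.continuous
  set lam := (∫ z, Real.exp (a * z) * k z) + c * a - 1 + r with hlamdef
  obtain ⟨R, hR, hest⟩ := bump_est (κ := fun z => Real.exp (a * z) * k z) (by fun_prop)
    (fun z => mul_nonneg (Real.exp_pos _).le (hk.2.1 z)) (by simpa using hk.2.2.2.2.1)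
    (hexp a) (mom_int hk hexp a).1 (mom_int hk hexp a).2 (half_pos hlam)
  refine ⟨R, hR, fun χ hχ => ?_⟩
  set ε := min 1 (lam / (2 * r)) * Real.exp (-(|a| * R)) with hε
  have hmin : 0 < min 1 (lam / (2 * r)) := lt_min one_pos (by positivity)
  have hε0 : 0 < ε := mul_pos hmin (Real.exp_pos _)
  let P : ℝ → ℝ := fun x => 1 - x ^ 2 / R ^ 2
  let v : ℝ → ℝ := fun x => ε * Real.exp (a * x) * max (P x) 0
  let u : ℝ → ℝ := fun x => ε * Real.exp (a * x) * P x
  let u' : ℝ → ℝ := fun x => ε * Real.exp (a * x) * (a * P x + -2 * x / R ^ 2)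
  have hPin : ∀ x, |x| ≤ R → 0 ≤ P x := fun x hx => by
    have : x ^ 2 ≤ R ^ 2 := by rw [← sq_abs x]; gcongr
    simp only [P]
    rw [sub_nonneg, div_le_one (by positivity)]; exact this
  have hPout : ∀ x, R ≤ |x| → P x ≤ 0 := fun x hx => by
    have : R ^ 2 ≤ x ^ 2 := by rw [← sq_abs x]; gcongr
    simp only [P]
    rw [sub_nonpos, one_le_div (by positivity)]; exact this
  have hP1 : ∀ x, P x ≤ 1 := fun x => by
    have : 0 ≤ x ^ 2 / R ^ 2 := by positivity
    simp only [P]; linarith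
  have hvc : Continuous v := by fun_prop
  have hvu : ∀ x, |x| ≤ R → v x = u x := fun x hx => by
    simp only [v, u, max_eq_left (hPin x hx)]
  have hv0 : ∀ x, R ≤ |x| → v x = 0 := fun x hx => by
    simp only [v, max_eq_right (hPout x hx), mul_zero]
  have hvn : ∀ x, 0 ≤ v x := fun x => mul_nonneg (mul_pos hε0 (Real.exp_pos _)).le (le_max_right _ _)
  have hvle : ∀ x, v x ≤ min 1 (lam / (2 * r)) := by
    intro x
    rcases le_total |x| R with h | h
    · have h1 : Real.exp (-(|a| * R)) * Real.exp (a * x) ≤ 1 := by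
        rw [← Real.exp_add, Real.exp_le_one_iff]
        have : a * x ≤ |a| * |x| := by rw [← abs_mul]; exact le_abs_self _
        nlinarith [abs_nonneg a]
      have h2 : max (P x) 0 ≤ 1 := max_le (hP1 x) zero_le_one
      calc v x = min 1 (lam / (2 * r)) * ((Real.exp (-(|a| * R)) * Real.exp (a * x)) * max (P x) 0) := by
            simp only [v, hε]; ring
        _ ≤ min 1 (lam / (2 * r)) * 1 := by
            refine mul_le_mul_of_nonneg_left ?_ hmin.le
            exact mul_le_one₀ h1 (le_max_right _ _) h2
        _ = _ := mul_one _
    · rw [hv0 x h]; exact hmin.le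
  have hadm : Adm v := ⟨hvc.measurable, fun x => ⟨hvn x, (hvle x).trans (min_le_left _ _)⟩⟩
  have hud : ∀ x, HasDerivAt u (u' x) x := by
    intro x
    have d1 : HasDerivAt (fun x : ℝ => Real.exp (a * x)) (Real.exp (a * x) * a) x := by
      simpa using ((hasDerivAt_id x).const_mul a).exp
    have d2 : HasDerivAt P (-(2 * x) / R ^ 2) x := by
      have := ((hasDerivAt_pow 2 x).div_const (R ^ 2)).const_sub 1
      refine this.congr_deriv ?_
      simp
      ring
    refine ((d1.const_mul ε).mul d2).congr_deriv ?_
    simp only [u']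
    ring
  classical
  refine ⟨v, fun x => if -R ≤ x ∧ x < R then u' x else 0, hadm, hvc, fun x => ?_, fun x => ?_, ?_⟩
  · by_cases hx : -R ≤ x ∧ x < R
    · beta_reduce; rw [if_pos hx]
      refine (hud x).hasDerivWithinAt.congr_of_eventuallyEq ?_
        (hvu x (abs_le.2 ⟨hx.1, hx.2.le⟩))
      filter_upwards [self_mem_nhdsWithin, mem_nhdsWithin_of_mem_nhds (Iio_mem_nhds hx.2)] with y h1 h2
      exact hvu y (abs_le.2 ⟨hx.1.trans h1, le_of_lt h2⟩)
    · beta_reduce; rw [if_neg hx]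
      have hx' : x < -R ∨ R ≤ x := by
        by_contra hh
        push Not at hh
        exact hx hh
      refine (hasDerivWithinAt_const x (Ici x) (0:ℝ)).congr_of_eventuallyEq ?_ ?_
      · rcases hx' with h | h
        · filter_upwards [mem_nhdsWithin_of_mem_nhds (Iio_mem_nhds h)] with y hy
          refine hv0 y ?_
          rw [mem_Iio] at hy
          rw [abs_of_neg (by linarith)]; linarith
        · filter_upwards [self_mem_nhdsWithin] with y hy
          rw [mem_Ici] at hy
          exact hv0 y ((h.trans hy).trans (le_abs_self y))
      · refine hv0 x ?_
        rcases hx' with h | h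
        · rw [abs_of_neg (by linarith)]; linarith
        · exact h.trans (le_abs_self x)
  · by_cases hx : -R ≤ x ∧ x < R
    · beta_reduce; rw [if_pos hx]
      have hxa : |x| ≤ R := abs_le.2 ⟨hx.1, hx.2.le⟩
      rw [hχ x hxa]
      have hKv : KK k v x = ε * Real.exp (a * x) *
          ∫ z, Real.exp (a * z) * k z * max (1 - (z + x) ^ 2 / R ^ 2) 0 := by
        rw [KK, ← integral_add_right_eq_self _ x, ← integral_const_mul]
        refine integral_congr_ae (Eventually.of_forall fun z => ?_)
        simp only [v, P, add_sub_cancel_right]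
        rw [mul_add, Real.exp_add]
        ring
      have h1 := hest x hxa
      rw [ha] at h1
      have hE : 0 < ε * Real.exp (a * x) := mul_pos hε0 (Real.exp_pos _)
      have hrv : r * v x ≤ lam / 2 := by
        have := (hvle x).trans (min_le_right _ _)
        rw [le_div_iff₀ (by positivity)] at this
        linarith
      have hPx := hPin x hxa
      have h2 : 0 ≤ c * (a * P x + -2 * x / R ^ 2) +
          ((∫ z, Real.exp (a * z) * k z * max (1 - (z + x) ^ 2 / R ^ 2) 0) - P x) +
          r * (1 - v x) * P x := by
        have h3 := mul_le_mul_of_nonneg_right hrv hPx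
        simp only [P] at h3 ⊢
        have h4 : (∫ z, Real.exp (a * z) * k z) = lam - c * a + 1 - r := by rw [hlamdef]; ring
        rw [h4] at h1
        linarith
      have h5 := mul_nonneg hE.le h2
      rw [hKv]
      have h6 : v x = ε * Real.exp (a * x) * P x := hvu x hxa
      have h7 : u' x = ε * Real.exp (a * x) * (a * P x + -2 * x / R ^ 2) := rfl
      rw [h7]
      calc _ ≤ _ := h5
        _ = c * (ε * Real.exp (a * x) * (a * P x + -2 * x / R ^ 2)) +
          (ε * Real.exp (a * x) *
            (∫ z, Real.exp (a * z) * k z * max (1 - (z + x) ^ 2 / R ^ 2) 0) -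
              ε * Real.exp (a * x) * P x) +
          (-q + (r * (1 - v x) + q) * 1) * (ε * Real.exp (a * x) * P x) := by ring
        _ = _ := by rw [← h6]
    · beta_reduce; rw [if_neg hx]
      have hx' : R ≤ |x| := by
        by_contra hh
        push Not at hh
        exact hx ⟨(abs_lt.1 hh).1.le, (abs_lt.1 hh).2⟩
      rw [hv0 x hx']
      simpa using KK_nonneg hk hadm x
  · simp only [v, P]
    simpa using hε0

lemma chi_adm {L L0 : ℝ} {ρ : ℝ → ℝ} (hL : 0 < L) (hL0 : 0 < L0)
    (hρC : ContDiff ℝ 1 ρ) (hρrange : ∀ x, ρ x ∈ Set.Icc (0:ℝ) 1) (hρ1 : ∀ x ≤ (0:ℝ), ρ x = 1) :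
    Adm (fun x => ρ ((|x| - L) / L0)) ∧ ContDiff ℝ 1 (fun x => ρ ((|x| - L) / L0)) := by
  have hc := hρC.continuous
  refine ⟨⟨Continuous.measurable (by fun_prop), fun x => hρrange _⟩, ?_⟩
  rw [contDiff_iff_contDiffAt]
  intro x
  by_cases hx : x = 0
  · refine (contDiffAt_const (c := (1:ℝ))).congr_of_eventuallyEq ?_
    have : Metric.ball x L ∈ 𝓝 x := Metric.ball_mem_nhds _ hL
    filter_upwards [this] with y hy
    apply hρ1
    rw [hx, mem_ball_zero_iff, Real.norm_eq_abs] at hy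
    exact div_nonpos_of_nonpos_of_nonneg (by linarith) hL0.le
  · refine ContDiffAt.comp x hρC.contDiffAt ?_
    exact ((contDiffAt_abs hx).sub contDiffAt_const).div_const _

/-- Existence of the patch-size threshold `L*` for traveling waves
when `0 ≤ c < c*`. -/
theorem existence_patch_size_threshold
    (k : ℝ → ℝ) (hk : H1 k) (hexp : EXPk k)
    (r q L0 : ℝ) (hr : 0 < r) (hq : 0 < q) (hL0 : 0 < L0)
    (ρ : ℝ → ℝ) (hρC : ContDiff ℝ 1 ρ) (hρrange : ∀ x, ρ x ∈ Set.Icc (0:ℝ) 1)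
    (hρ1 : ∀ x ≤ (0:ℝ), ρ x = 1) (hρ0 : ∀ x : ℝ, 1 ≤ x → ρ x = 0) (hρmono : Antitone ρ)
    (c : ℝ) (hc0 : 0 ≤ c) (hc : c < cstar k r) :
    ∃ Lstar : ℝ, 0 ≤ Lstar ∧
      (∀ L, Lstar < L →
        ∃ Φ, IsTW c k (fun x u => -q + (r * (1 - u) + q) * ρ ((|x| - L) / L0)) Φ) ∧
      (∀ L, 0 < L → L < Lstar →
        ¬ ∃ Φ, IsTW c k (fun x u => -q + (r * (1 - u) + q) * ρ ((|x| - L) / L0)) Φ) := by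
  have hS : ∃ L, 0 < L ∧
      ∃ Φ, IsTW c k (fun x u => -q + (r * (1 - u) + q) * ρ ((|x| - L) / L0)) Φ := by
    obtain ⟨R, hR, h⟩ := base_sub (q := q) hk hexp hr hc0 hc
    obtain ⟨v, v', h1, h2, h3, h4, h5⟩ := h (fun x => ρ ((|x| - R) / L0)) (fun x hx =>
      hρ1 _ (div_nonpos_of_nonpos_of_nonneg (by linarith) hL0.le))
    obtain ⟨hχ, hχc⟩ := chi_adm hR hL0 hρC hρrange hρ1
    exact ⟨R, hR, exists_TW hk hr hq hχ hχc hc0 h1 h2 h3 h4 h5⟩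
  have hmono : ∀ L L', 0 < L → L < L' →
      (∃ Φ, IsTW c k (fun x u => -q + (r * (1 - u) + q) * ρ ((|x| - L) / L0)) Φ) →
      ∃ Φ, IsTW c k (fun x u => -q + (r * (1 - u) + q) * ρ ((|x| - L') / L0)) Φ := by
    rintro L L' hL hLL ⟨Φ, hΦC, hΦp, ⟨C, hC⟩, hΦ⟩
    obtain ⟨hχ, hχc⟩ := chi_adm (hL.trans hLL) hL0 hρC hρrange hρ1
    have hD : 0 < max C 1 := lt_max_of_lt_right one_pos
    set ε := (max C 1)⁻¹ with hε
    have hε0 : 0 < ε := inv_pos.2 hD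
    have hε1 : ε ≤ 1 := inv_le_one_of_one_le₀ (le_max_right _ _)
    have hεΦ : ∀ x, ε * Φ x ≤ 1 := fun x => by
      rw [hε, inv_mul_le_iff₀ hD, mul_one]
      exact (hC x).trans (le_max_left _ _)
    have hΦc := hΦC.continuous
    refine exists_TW hk hr hq hχ hχc hc0 (v := fun x => ε * Φ x) (v' := fun x => ε * deriv Φ x)
      ⟨Continuous.measurable (by fun_prop), fun x => ⟨(mul_pos hε0 (hΦp x)).le, hεΦ x⟩⟩
      (by fun_prop) (fun x => ?_) (fun x => ?_) (x0 := 0) (mul_pos hε0 (hΦp 0))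
    · exact (((hΦC.differentiable one_ne_zero x).hasDerivAt).const_mul ε).hasDerivWithinAt
    · have hKK : KK k (fun x => ε * Φ x) x = ε * ∫ η, k (η - x) * Φ η := by
        rw [KK, ← integral_const_mul]
        refine integral_congr_ae (Eventually.of_forall fun z => ?_)
        simp only []
        ring
      rw [hKK]
      have h1 := hΦ x
      simp only [] at h1 ⊢
      set X := ρ ((|x| - L) / L0) with hX
      set X' := ρ ((|x| - L') / L0) with hX'
      have hXX : X ≤ X' := hρmono (by gcongr)
      have hX0 : 0 ≤ X := (hρrange _).1
      have h2 : (r * (1 - Φ x) + q) * X ≤ (r * (1 - ε * Φ x) + q) * X' := by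
        have h3 : ε * Φ x ≤ Φ x := mul_le_of_le_one_left (hΦp x).le hε1
        calc (r * (1 - Φ x) + q) * X ≤ (r * (1 - ε * Φ x) + q) * X := by gcongr
          _ ≤ _ := by
            refine mul_le_mul_of_nonneg_left hXX ?_
            have := mul_nonneg hr.le (sub_nonneg.2 (hεΦ x))
            linarith
      have h4 := mul_le_mul_of_nonneg_right h2 (mul_pos hε0 (hΦp x)).le
      have h5 := congrArg (fun y => ε * y) h1
      simp only [mul_zero] at h5
      nlinarith
  set S : Set ℝ := {L | 0 < L ∧
      ∃ Φ, IsTW c k (fun x u => -q + (r * (1 - u) + q) * ρ ((|x| - L) / L0)) Φ} with hSdef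
  have hbdd : BddBelow S := ⟨0, fun L hL => hL.1.le⟩
  refine ⟨sInf S, Real.sInf_nonneg fun L hL => hL.1.le, fun L hL => ?_, fun L hL0' hL hex => ?_⟩
  · obtain ⟨L1, hL1, hlt⟩ := exists_lt_of_csInf_lt hS hL
    exact hmono L1 L hL1.1 hlt hL1.2
  · exact absurd (csInf_le hbdd (show L ∈ S from ⟨hL0', hex⟩)) (not_le.2 hL)
end
end

section
/- (Nonexistence of traveling waves for c>c*.) Assume (H1), (EXP) and (H2), and suppose c > c*, where c* := inf_{μ>0} (∫_ℝ e^{−μ z} k(z) dz − 1 + r)/μ. Then there is no bounded positive traveling-wave profile; that is, there is no bounded C¹ function Φ:ℝ→(0,∞) satisfying c Φ'(ξ)+∫_ℝ k(η−ξ) Φ(η) dη − Φ(ξ) + f(ξ,Φ(ξ)) Φ(ξ)=0 for all ξ∈ℝ. -/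
open MeasureTheory Real Set Filter Topology

noncomputable section

lemma aux_max (g : ℝ → ℝ) (hg : Differentiable ℝ g) (S : ℝ) (hS : ∀ x, g x ≤ S)
    (hl : ∀ e : ℝ, 0 < e → ∃ x, S - e < g x) (ε : ℝ) (hε : 0 < ε) :
    ∃ x, S - ε < g x ∧ deriv g x ≤ ε := by
  obtain ⟨x0, hx0⟩ := hl ε hε
  obtain ⟨x1, hx1, hmax⟩ := (isCompact_Icc (a := x0) (b := x0 + 2)).exists_isMaxOn
    ⟨x0, by constructor <;> linarith⟩ (f := fun x => g x - ε * (x - x0))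
    (by have := hg.continuous; fun_prop)
  have h0 : g x0 ≤ g x1 - ε * (x1 - x0) := by
    have := hmax (show x0 ∈ Icc x0 (x0 + 2) by constructor <;> linarith)
    simpa using this
  have h1 : g x0 ≤ g x1 := by
    have : 0 ≤ ε * (x1 - x0) := mul_nonneg hε.le (by linarith [hx1.1])
    linarith
  have hlt : x1 < x0 + 2 := by
    rcases hx1.2.lt_or_eq with h | h
    · exact h
    · rw [h] at h0
      have := hS (x0 + 2)
      linarith
  refine ⟨x1, by linarith, ?_⟩
  have hd := (hg x1).hasDerivAt.hasDerivWithinAt (s := Ioi x1)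
  rw [hasDerivWithinAt_iff_tendsto_slope' (by simp)] at hd
  refine le_of_tendsto hd ?_
  filter_upwards [Ioo_mem_nhdsGT hlt] with y hy
  have h2 := hmax (show y ∈ Icc x0 (x0 + 2) from ⟨by linarith [hx1.1, hy.1], hy.2.le⟩)
  simp only [mem_ofPred_eq] at h2
  rw [slope_def_field, div_le_iff₀ (by linarith [hy.1])]
  linarith

lemma aux_max' (g : ℝ → ℝ) (hg : Differentiable ℝ g) (B : ℝ) (hB : ∀ x, g x ≤ B) :
    ∃ S, (∀ x, g x ≤ S) ∧ ∀ ε, 0 < ε → ∃ x, S - ε < g x ∧ deriv g x ≤ ε := by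
  have hb : BddAbove (range g) := ⟨B, by rintro _ ⟨x, rfl⟩; exact hB x⟩
  refine ⟨sSup (range g), fun x => le_csSup hb ⟨x, rfl⟩, ?_⟩
  refine aux_max g hg _ (fun x => le_csSup hb ⟨x, rfl⟩) ?_
  intro e he
  obtain ⟨_, ⟨x, rfl⟩, h⟩ := exists_lt_of_lt_csSup (range_nonempty g)
    (show sSup (range g) - e < sSup (range g) by linarith)
  exact ⟨x, h⟩

/-- Nonexistence of traveling waves for `c > c*`. -/
theorem nonexistence_traveling_wave
    (k : ℝ → ℝ) (hk : H1 k) (hexp : EXPk k)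
    (r q L L0 : ℝ) (χ : ℝ → ℝ) (hχ : IsH2chi r q L L0 χ)
    (c : ℝ) (hc : cstar k r < c) :
    ¬ ∃ Φ, IsTW c k (fH2 r q χ) Φ := by
  rintro ⟨Φ, hΦ, hpos, ⟨B, hB⟩, heq⟩
  obtain ⟨hkC, hk0, hks, hk1, -, -⟩ := hk
  obtain ⟨hr, hq, hL, hL0, -, hχ01, -, -, hχ0, -⟩ := hχ
  obtain ⟨_, ⟨μ, hμ, rfl⟩, hlt⟩ := exists_lt_of_csInf_lt (by exact ⟨_, 1, one_pos, rfl⟩) hc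
  rw [div_lt_iff₀ hμ] at hlt
  set K := ∫ z, Real.exp (-(μ * z)) * k z with hK
  have hki : Integrable k := by simpa using hexp 0
  have hKi : Integrable (fun z => Real.exp (-(μ * z)) * k z) := by
    simpa [neg_mul] using hexp (-μ)
  have hK1 : 1 ≤ K := by
    have e1 : K = ∫ z, Real.exp (μ * z) * k z := by
      rw [hK, ← integral_neg_eq_self]
      simp [hks]
    have e2 : (∫ z, (Real.exp (-(μ * z)) * k z + Real.exp (μ * z) * k z)) = K + K := by
      rw [integral_add hKi (hexp μ), ← e1]
    have e3 : (∫ z, 2 * k z) ≤ ∫ z, (Real.exp (-(μ * z)) * k z + Real.exp (μ * z) * k z) := by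
      refine integral_mono (hki.const_mul 2) (hKi.add (hexp μ)) fun z => ?_
      have := Real.add_one_le_exp (μ * z)
      have := Real.add_one_le_exp (-(μ * z))
      have := hk0 z
      simp only [Pi.add_apply]
      nlinarith
    rw [integral_const_mul, hk1, e2] at e3
    linarith
  have hc0 : 0 < c := by
    by_contra! h
    nlinarith
  have hki' : ∀ x, Integrable (fun η => k (η - x)) := fun x => hki.comp_sub_right x
  have hk1' : ∀ x, ∫ η, k (η - x) = 1 := fun x => by rw [integral_sub_right_eq_self, hk1]
  have hform : ∀ x, (fun η => k (η - x) * Real.exp (-(μ * η))) =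
      fun η => Real.exp (-(μ * x)) * (fun z => Real.exp (-(μ * z)) * k z) (η - x) := by
    intro x
    funext η
    have : Real.exp (-(μ * η)) = Real.exp (-(μ * x)) * Real.exp (-(μ * (η - x))) := by
      rw [← Real.exp_add]; congr 1; ring
    simp only [this]; ring
  have hEi : ∀ x, Integrable (fun η => k (η - x) * Real.exp (-(μ * η))) := fun x => by
    rw [hform x]
    exact (hKi.comp_sub_right x).const_mul _
  have hEv : ∀ x, ∫ η, k (η - x) * Real.exp (-(μ * η)) = Real.exp (-(μ * x)) * K := fun x => by
    rw [hform x, integral_const_mul,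
      integral_sub_right_eq_self (fun z => Real.exp (-(μ * z)) * k z) x]
  have hΦi : ∀ x, Integrable (fun η => k (η - x) * Φ η) := fun x => by
    refine Integrable.mono' ((hki' x).mul_const B)
      (by have := hkC.continuous; have := hΦ.continuous
          exact Continuous.aestronglyMeasurable (by fun_prop)) (Eventually.of_forall fun η => ?_)
    rw [Real.norm_eq_abs, abs_of_nonneg (mul_nonneg (hk0 _) (hpos _).le)]
    exact mul_le_mul_of_nonneg_left (hB η) (hk0 _)
  -- convolution bound
  have hconv : ∀ S A x, (∀ η, Φ η ≤ S + A * Real.exp (-(μ * η))) →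
      ∫ η, k (η - x) * Φ η ≤ S + A * (Real.exp (-(μ * x)) * K) := by
    intro S A x h
    have e : ∫ η, (k (η - x) * S + A * (k (η - x) * Real.exp (-(μ * η)))) =
        S + A * (Real.exp (-(μ * x)) * K) := by
      rw [integral_add ((hki' x).mul_const S) ((hEi x).const_mul A), integral_mul_const,
        integral_const_mul, hEv, hk1', one_mul]
    rw [← e]
    refine integral_mono (hΦi x) (((hki' x).mul_const S).add ((hEi x).const_mul A)) fun η => ?_
    have := mul_le_mul_of_nonneg_left (h η) (hk0 (η - x))
    simp only [Pi.add_apply]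
    linarith
  have hΦd : Differentiable ℝ Φ := hΦ.differentiable (by simp)
  have hEd : ∀ x, HasDerivAt (fun x => Real.exp (-(μ * x))) (Real.exp (-(μ * x)) * (-μ)) x := by
    intro x
    have := (((hasDerivAt_id x).const_mul μ).neg).exp
    simpa using this
  -- Step 1
  have hB0 : 0 < B := (hpos 0).trans_le (hB 0)
  obtain ⟨A, hA⟩ : ∃ A, A = B * Real.exp (μ * (L + L0)) := ⟨_, rfl⟩
  have hA0 : 0 < A := by rw [hA]; positivity
  have step1 : ∀ x, Φ x ≤ A * Real.exp (-(μ * x)) := by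
    have hψd : ∀ x, HasDerivAt (fun x => Φ x - A * Real.exp (-(μ * x)))
        (deriv Φ x - A * (Real.exp (-(μ * x)) * (-μ))) x := fun x =>
      (hΦd x).hasDerivAt.sub ((hEd x).const_mul A)
    obtain ⟨S, hS, hS2⟩ := aux_max' (fun x => Φ x - A * Real.exp (-(μ * x)))
      (fun x => (hψd x).differentiableAt) B (fun x => by
        have : 0 < A * Real.exp (-(μ * x)) := by positivity
        linarith [hB x])
    suffices S ≤ 0 by intro x; linarith [hS x]
    by_contra! hS0
    obtain ⟨ε, hε⟩ : ∃ ε, ε = q * S / (2 * (1 + q + c)) := ⟨_, rfl⟩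
    have hε0 : 0 < ε := by rw [hε]; positivity
    have hε1 : 2 * (1 + q + c) * ε = q * S := by rw [hε]; field_simp
    have hεS : ε < S := by nlinarith
    obtain ⟨x, hx, hx'⟩ := hS2 ε hε0
    rw [(hψd x).deriv] at hx'
    have hxR : L + L0 < x := by
      by_contra! h
      have h1 : A * Real.exp (-(μ * x)) = B * Real.exp (μ * (L + L0 - x)) := by
        rw [hA, mul_assoc, ← Real.exp_add]; congr 2; ring
      have h2 : 1 ≤ Real.exp (μ * (L + L0 - x)) := Real.one_le_exp (by nlinarith)
      nlinarith [hB x]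
    have hχx : χ x = 0 := hχ0 x (hxR.le.trans (le_abs_self x))
    have he := heq x
    simp only [fH2, hχx] at he
    have hcv := hconv S A x (fun η => by linarith [hS η])
    set E := Real.exp (-(μ * x)) with hE
    have hAE : 0 < A * E := by positivity
    have h3 : c * (deriv Φ x - A * (E * (-μ))) ≤ c * ε := mul_le_mul_of_nonneg_left hx' hc0.le
    have h4 : 0 < (A * E) * (1 + q + c * μ - K) := mul_pos hAE (by linarith)
    have h5 : (1 + q) * (S - ε) < (1 + q) * (Φ x - A * E) := by gcongr
    nlinarith
  -- Step 2
  have hExp2 : ∀ x, HasDerivAt (fun x => Real.exp (μ * x)) (Real.exp (μ * x) * μ) x := by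
    intro x
    have := ((hasDerivAt_id x).const_mul μ).exp
    simpa using this
  have hpd : ∀ x, HasDerivAt (fun x => Φ x * Real.exp (μ * x))
      (deriv Φ x * Real.exp (μ * x) + Φ x * (Real.exp (μ * x) * μ)) x := fun x =>
    (hΦd x).hasDerivAt.mul (hExp2 x)
  have hinv : ∀ x, Real.exp (-(μ * x)) * Real.exp (μ * x) = 1 := fun x => by
    rw [← Real.exp_add]; simp
  obtain ⟨S, hS, hS2⟩ := aux_max' (fun x => Φ x * Real.exp (μ * x))
    (fun x => (hpd x).differentiableAt) A (fun x => by
      have := mul_le_mul_of_nonneg_right (step1 x) (Real.exp_pos (μ * x)).le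
      rwa [mul_assoc, hinv, mul_one] at this)
  have hS0 : 0 < S := lt_of_lt_of_le (mul_pos (hpos 0) (Real.exp_pos _)) (hS 0)
  have hG : 0 < c * μ + 1 - r - K := by linarith
  have hD : 0 < c + (c * μ + 1 - r) := by linarith
  obtain ⟨ε, hε⟩ : ∃ ε, ε = (c * μ + 1 - r - K) * S / (2 * (c + (c * μ + 1 - r))) := ⟨_, rfl⟩
  have hε0 : 0 < ε := by rw [hε]; positivity
  have hε1 : 2 * ((c + (c * μ + 1 - r)) * ε) = (c * μ + 1 - r - K) * S := by
    rw [hε]; generalize c + (c * μ + 1 - r) = D at *; field_simp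
  obtain ⟨x, hx, hx'⟩ := hS2 ε hε0
  rw [(hpd x).deriv] at hx'
  have hcv := hconv 0 S x (fun η => by
    have := mul_le_mul_of_nonneg_right (hS η) (Real.exp_pos (-(μ * η))).le
    simp only [mul_assoc] at this
    rw [mul_comm (Real.exp (μ * η)), hinv, mul_one] at this
    linarith)
  have hf : fH2 r q χ x (Φ x) ≤ r := by
    simp only [fH2]
    have h1 := (hχ01 x).1
    have h2 := (hχ01 x).2
    have := mul_nonneg (mul_nonneg hr.le (hpos x).le) h1
    nlinarith
  have hfΦ := mul_le_mul_of_nonneg_right hf (hpos x).le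
  have he := heq x
  have hi := hinv x
  set F := Real.exp (μ * x) with hF
  set E := Real.exp (-(μ * x)) with hE
  have hF0 : 0 < F := Real.exp_pos _
  have h1 : (1 - r) * Φ x - S * (E * K) ≤ c * deriv Φ x := by linarith
  have h2 := mul_le_mul_of_nonneg_right h1 hF0.le
  have h3 : ((1 - r) * Φ x - S * (E * K)) * F = (1 - r) * (Φ x * F) - S * K := by
    linear_combination (-(S * K)) * hi
  have h4 := mul_le_mul_of_nonneg_left hx' hc0.le
  have h5 : (c * μ + 1 - r) * (S - ε) < (c * μ + 1 - r) * (Φ x * F) :=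
    mul_lt_mul_of_pos_left hx (by linarith)
  have h6 := mul_pos hD hε0
  nlinarith
end
end

section
/- (Uniqueness of traveling waves.) Assume (H1), (EXP) and (H2), and let c≥0. If Φ₁ and Φ₂ are both bounded positive traveling-wave profiles, i.e. bounded C¹ functions ℝ→(0,∞) satisfying c Φᵢ'(ξ)+∫_ℝ k(η−ξ) Φᵢ(η) dη − Φᵢ(ξ) + f(ξ,Φᵢ(ξ)) Φᵢ(ξ)=0 for all ξ∈ℝ (i=1,2), then Φ₁(ξ)=Φ₂(ξ) for all ξ∈ℝ. -/
open MeasureTheory Real Set Filter Topology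

noncomputable section

lemma conv_int (k w : ℝ → ℝ) (hki : Integrable k) (hw : Continuous w)
    (C : ℝ) (hC : ∀ x, |w x| ≤ C) (x : ℝ) : Integrable (fun η => k (η - x) * w η) := by
  have h1 : Integrable (fun η => k (η - x)) := hki.comp_sub_right x
  exact h1.mul_bdd (c := C) hw.aestronglyMeasurable (Filter.Eventually.of_forall (fun y => by
    simpa using hC y))

lemma min_principle (k w : ℝ → ℝ) (hk0 : ∀ z, 0 ≤ k z) (hki : Integrable k) (h1 : ∫ z, k z = 1)
    (hd : Differentiable ℝ w) (C : ℝ) (hC : ∀ x, |w x| ≤ C) (q c R : ℝ) (hq : 0 < q) (hc : 0 ≤ c)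
    (hin : ∀ x, |x| ≤ R → 0 ≤ w x)
    (heq : ∀ x, R ≤ |x| → c * deriv w x + ((∫ η, k (η - x) * w η) - w x) - q * w x = 0) :
    ∀ x, 0 ≤ w x := by
  by_contra hneg
  push Not at hneg
  obtain ⟨x0, hx0⟩ := hneg
  have hbdd : BddBelow (range w) := ⟨-C, by rintro _ ⟨y, rfl⟩; exact (abs_le.1 (hC y)).1⟩
  set a := sInf (range w) with ha
  have hal : ∀ x, a ≤ w x := fun x => csInf_le hbdd ⟨x, rfl⟩
  have ha0 : a < 0 := (hal x0).trans_lt hx0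
  have hconv : ∀ x, a ≤ ∫ η, k (η - x) * w η := by
    intro x
    have e : ∫ η, k (η - x) * a = a := by
      rw [integral_mul_const, integral_sub_right_eq_self k x, h1, one_mul]
    rw [← e]
    apply integral_mono ((hki.comp_sub_right x).mul_const a) (conv_int k w hki hd.continuous C hC x)
    intro y
    exact mul_le_mul_of_nonneg_left (hal y) (hk0 _)
  set δ := -(q * a) / (4 * (1 + q)) with hδ
  have hδe : δ * (1 + q) * 4 = -(q * a) := by rw [hδ]; field_simp
  have hδ0 : 0 < δ := by
    rw [hδ]; apply div_pos
    · nlinarith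
    · linarith
  obtain ⟨_, ⟨y, rfl⟩, hy⟩ := exists_lt_of_csInf_lt (range_nonempty w)
    (show sInf (range w) < a + δ by rw [← ha]; linarith)
  set g : ℝ → ℝ := fun x => Real.log (1 + x ^ 2) with hg
  have hg0 : ∀ x, 0 ≤ g x := fun x => Real.log_nonneg (by nlinarith [sq_nonneg x])
  have hgd : ∀ x, HasDerivAt g (2 * x / (1 + x ^ 2)) x := by
    intro x
    have h : HasDerivAt (fun x : ℝ => 1 + x ^ 2) (2 * x) x := by
      simpa using (hasDerivAt_pow 2 x).const_add 1
    exact h.log (by positivity)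
  have hgb : ∀ x : ℝ, -1 ≤ 2 * x / (1 + x ^ 2) := by
    intro x
    rw [le_div_iff₀ (by positivity)]
    nlinarith [sq_nonneg (x + 1)]
  have hgb2 : ∀ x : ℝ, 2 * x / (1 + x ^ 2) ≤ 1 := by
    intro x
    rw [div_le_iff₀ (by positivity)]
    nlinarith [sq_nonneg (x - 1)]
  have hgc : Continuous g := continuous_iff_continuousAt.2 fun x => (hgd x).continuousAt
  have hgt : Tendsto g (cocompact ℝ) atTop := by
    apply Real.tendsto_log_atTop.comp
    apply tendsto_atTop_add_const_left
    have := (tendsto_pow_atTop (α := ℝ) two_ne_zero).comp (tendsto_norm_cocompact_atTop (E := ℝ))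
    refine this.congr (fun x => ?_)
    simp
  have hD : 0 < 1 + g y + c := by linarith [hg0 y]
  set ε := δ / (1 + g y + c) with hε
  have hε0 : 0 < ε := div_pos hδ0 hD
  have hεe : ε * (1 + g y + c) = δ := by rw [hε]; field_simp
  have hεg : ε * g y ≤ δ := by nlinarith [mul_nonneg hε0.le hc]
  have hεc : ε * c ≤ δ := by nlinarith [mul_nonneg hε0.le (hg0 y)]
  have hcont : Continuous (fun x => w x + ε * g x) := by
    have := hd.continuous
    fun_prop
  have hcoer : Tendsto (fun x => w x + ε * g x) (cocompact ℝ) atTop :=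
    tendsto_atTop_add_left_of_le _ a hal (hgt.const_mul_atTop hε0)
  obtain ⟨x, hx⟩ := hcont.exists_forall_le hcoer
  have hder : HasDerivAt (fun x => w x + ε * g x) (deriv w x + ε * (2 * x / (1 + x ^ 2))) x :=
    (hd x).hasDerivAt.add ((hgd x).const_mul ε)
  have hz : deriv w x + ε * (2 * x / (1 + x ^ 2)) = 0 :=
    IsLocalMin.hasDerivAt_eq_zero (Filter.Eventually.of_forall hx) hder
  have hwx : w x ≤ a + 2 * δ := by
    have := hx y
    have := mul_nonneg hε0.le (hg0 x)
    linarith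
  have hwneg : w x < 0 := by nlinarith
  have hxR : R ≤ |x| := by
    by_contra h
    push Not at h
    linarith [hin x h.le]
  have h2 := heq x hxR
  have h3 := hconv x
  have h4 : -ε ≤ deriv w x := by
    have := mul_le_mul_of_nonneg_left (hgb2 x) hε0.le
    linarith
  have h5 : -δ ≤ c * deriv w x := by
    have := mul_le_mul_of_nonneg_left h4 hc
    linarith
  nlinarith [mul_le_mul_of_nonneg_left hwx hq.le]

lemma tw_le (k : ℝ → ℝ) (hk : H1 k) (r q L L0 : ℝ) (χ : ℝ → ℝ) (hχ : IsH2chi r q L L0 χ)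
    (c : ℝ) (hc : 0 ≤ c) (Φ₁ Φ₂ : ℝ → ℝ)
    (hΦ₁ : IsTW c k (fH2 r q χ) Φ₁) (hΦ₂ : IsTW c k (fH2 r q χ) Φ₂) :
    ∀ ξ, Φ₂ ξ ≤ Φ₁ ξ := by
  obtain ⟨hkC, hk0, hks, hk1, hkp, -⟩ := hk
  obtain ⟨hr, hq, hL, hL0, hχC, hχI, hχs, hχ1, hχ0, -⟩ := hχ
  obtain ⟨hC1, hp1, ⟨B1, hB1⟩, he1⟩ := hΦ₁
  obtain ⟨hC2, hp2, ⟨B2, hB2⟩, he2⟩ := hΦ₂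
  have hki : Integrable k := by
    by_contra h
    rw [integral_undef h] at hk1
    exact zero_ne_one hk1
  have hd1 : Differentiable ℝ Φ₁ := hC1.differentiable one_ne_zero
  have hd2 : Differentiable ℝ Φ₂ := hC2.differentiable one_ne_zero
  set R := L + L0 with hR
  have hR0 : 0 < R := by linarith
  have hqc : Continuous (fun x => Φ₂ x / Φ₁ x) :=
    hC2.continuous.div hC1.continuous (fun x => (hp1 x).ne')
  obtain ⟨ξ0, -, hξ0⟩ := (isCompact_Icc (a := -R) (b := R)).exists_isMaxOn
    ⟨0, by constructor <;> linarith⟩ hqc.continuousOn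
  set l := Φ₂ ξ0 / Φ₁ ξ0 with hl
  have hl0 : 0 < l := div_pos (hp2 _) (hp1 _)
  set w : ℝ → ℝ := fun x => l * Φ₁ x - Φ₂ x with hw
  have hwd : Differentiable ℝ w := (hd1.const_mul l).sub hd2
  have hwder : ∀ x, deriv w x = l * deriv Φ₁ x - deriv Φ₂ x := fun x =>
    (((hd1 x).hasDerivAt.const_mul l).sub (hd2 x).hasDerivAt).deriv
  have hwb : ∀ x, |w x| ≤ l * B1 + B2 := by
    intro x
    have := mul_le_mul_of_nonneg_left (hB1 x) hl0.le
    have := mul_pos hl0 (hp1 x)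
    have := hp2 x
    have := hB2 x
    rw [abs_le]; constructor <;> simp only [hw] <;> linarith
  have hi1 := conv_int k Φ₁ hki hC1.continuous B1 (fun x => by rw [abs_of_pos (hp1 x)]; exact hB1 x)
  have hi2 := conv_int k Φ₂ hki hC2.continuous B2 (fun x => by rw [abs_of_pos (hp2 x)]; exact hB2 x)
  have hiw := conv_int k w hki hwd.continuous _ hwb
  have hconv : ∀ x, ∫ η, k (η - x) * w η =
      l * (∫ η, k (η - x) * Φ₁ η) - ∫ η, k (η - x) * Φ₂ η := by
    intro x
    rw [← integral_const_mul, ← integral_sub ((hi1 x).const_mul l) (hi2 x)]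
    congr 1; ext y; simp only [hw]; ring
  have hmain : ∀ x, c * deriv w x + ((∫ η, k (η - x) * w η) - w x) - q * w x
      + χ x * ((r + q) * w x - r * (l * Φ₁ x ^ 2 - Φ₂ x ^ 2)) = 0 := by
    intro x
    rw [hwder, hconv]
    have a1 := he1 x
    have a2 := he2 x
    simp only [fH2] at a1 a2
    simp only [hw]
    linear_combination l * a1 - a2
  have hwnn : ∀ x, 0 ≤ w x := by
    apply min_principle k w hk0 hki hk1 hwd _ hwb q c R hq hc
    · intro x hx
      have : Φ₂ x / Φ₁ x ≤ l := hξ0 (abs_le.1 hx)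
      rw [div_le_iff₀ (hp1 x)] at this
      simp only [hw]; linarith
    · intro x hx
      have := hmain x
      rw [hχ0 x hx] at this
      linarith
  suffices hl1 : l ≤ 1 by
    intro x
    have := hwnn x
    simp only [hw] at this
    nlinarith [hp1 x]
  by_contra hl1
  push Not at hl1
  -- at a zero of w
  have hzero : ∀ x, w x = 0 → χ x = 0 ∧ ∫ η, k (η - x) * w η = 0 := by
    intro x hx
    have hder : deriv w x = 0 :=
      IsLocalMin.deriv_eq_zero (Filter.Eventually.of_forall (fun y => by rw [hx]; exact hwnn y))
    have hm := hmain x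
    rw [hder, hx] at hm
    have h2 : Φ₂ x = l * Φ₁ x := by simp only [hw] at hx; linarith
    rw [h2] at hm
    have hnn : 0 ≤ ∫ η, k (η - x) * w η := integral_nonneg fun y => mul_nonneg (hk0 _) (hwnn _)
    have hpos : 0 < r * (l * (l - 1) * Φ₁ x ^ 2) := by
      have := hp1 x
      have : 0 < l - 1 := by linarith
      positivity
    have hm' : (∫ η, k (η - x) * w η) + χ x * (r * (l * (l - 1) * Φ₁ x ^ 2)) = 0 := by
      linear_combination hm
    have hχn := (hχI x).1
    have hprod := mul_nonneg hχn hpos.le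
    constructor
    · have : χ x * (r * (l * (l - 1) * Φ₁ x ^ 2)) = 0 := by linarith
      rcases mul_eq_zero.1 this with h | h
      · exact h
      · exact absurd h hpos.ne'
    · linarith
  have hclosed : IsClosed {x | w x = 0} := isClosed_eq hwd.continuous continuous_const
  have hopen : IsOpen {x | w x = 0} := by
    rw [isOpen_iff_mem_nhds]
    intro x hx
    have hI := (hzero x hx).2
    have hcont : Continuous (fun η => k (η - x) * w η) :=
      (hkC.continuous.comp (continuous_id.sub continuous_const)).mul hwd.continuous
    have hz : (fun η => k (η - x) * w η) = 0 :=
      (hcont.ae_eq_iff_eq volume continuous_zero).1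
        ((integral_eq_zero_iff_of_nonneg (fun y => mul_nonneg (hk0 _) (hwnn _)) (hiw x)).1 hI)
    have hev : ∀ᶠ y in 𝓝 x, 0 < k (y - x) := by
      have hcc : ContinuousAt (fun y => k (y - x)) x :=
        (hkC.continuous.comp (continuous_id.sub continuous_const)).continuousAt
      apply hcc.eventually (lt_mem_nhds _)
      simpa using hkp
    filter_upwards [hev] with y hy
    have := congrFun hz y
    simp only [Pi.zero_apply] at this
    exact (mul_eq_zero.1 this).resolve_left hy.ne'
  have hξ : w ξ0 = 0 := by
    simp only [hw, hl]
    have := (hp1 ξ0).ne'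
    field_simp
    ring
  have huniv : {x | w x = 0} = univ := IsClopen.eq_univ ⟨hclosed, hopen⟩ ⟨ξ0, hξ⟩
  have h0 : w 0 = 0 := by
    have : (0:ℝ) ∈ {x | w x = 0} := by rw [huniv]; trivial
    exact this
  have := (hzero 0 h0).1
  rw [hχ1 0 (by simpa using hL.le)] at this
  exact one_ne_zero this

/-- Uniqueness of traveling waves. -/
theorem uniqueness_traveling_wave
    (k : ℝ → ℝ) (hk : H1 k) (hexp : EXPk k)
    (r q L L0 : ℝ) (χ : ℝ → ℝ) (hχ : IsH2chi r q L L0 χ)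
    (c : ℝ) (hc : 0 ≤ c)
    (Φ₁ Φ₂ : ℝ → ℝ)
    (hΦ₁ : IsTW c k (fH2 r q χ) Φ₁) (hΦ₂ : IsTW c k (fH2 r q χ) Φ₂) :
    ∀ ξ, Φ₁ ξ = Φ₂ ξ := by
  intro ξ
  exact le_antisymm (tw_le k hk r q L L0 χ hχ c hc Φ₂ Φ₁ hΦ₂ hΦ₁ ξ)
    (tw_le k hk r q L L0 χ hχ c hc Φ₁ Φ₂ hΦ₁ hΦ₂ ξ)
end
end

section
/- (Strict monotonicity of the auxiliary function h̃.) Assume (H1) and (EXP), and let q>0. Then the function h̃:(0,∞)→ℝ defined by h̃(μ) = (∫_ℝ e^{μη} k(η) dη − 1 − q)/μ is strictly increasing on (0,∞); equivalently, μ ∫_ℝ η e^{μη} k(η) dη − (∫_ℝ e^{μη} k(η) dη − 1 − q) > 0 for every μ>0. -/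
open MeasureTheory Real Set Filter Topology

noncomputable section

/-- Strict monotonicity of the auxiliary function `h̃`. -/
theorem htilde_strictMono
    (k : ℝ → ℝ) (hk : H1 k) (hexp : EXPk k)
    (q : ℝ) (hq : 0 < q) :
    StrictMonoOn (fun μ => ((∫ η, Real.exp (μ * η) * k η) - 1 - q) / μ) (Set.Ioi 0) ∧
    ∀ μ : ℝ, 0 < μ →
      0 < μ * (∫ η, η * Real.exp (μ * η) * k η) -
        ((∫ η, Real.exp (μ * η) * k η) - 1 - q) := by
  obtain ⟨hC, h0, -, h1, -, -⟩ := hk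
  have hki : Integrable k := by simpa using hexp 0
  have hmeas : Continuous k := hC.continuous
  constructor
  · intro a ha b hb hab
    have ha : 0 < a := ha
    have hb : 0 < b := hb
    have key : (∫ η, Real.exp (a * η) * k η) ≤
        ∫ η, ((a / b) * (Real.exp (b * η) * k η) + (1 - a / b) * k η) := by
      refine integral_mono (hexp a) (((hexp b).const_mul _).add (hki.const_mul _)) ?_
      intro η
      have hab1 : a / b ≤ 1 := by rw [div_le_one hb]; exact hab.le
      have hc := convexOn_exp.2 (mem_univ (b * η)) (mem_univ (0:ℝ))
        (div_pos ha hb).le (sub_nonneg.2 hab1) (by ring)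
      have e : a / b * (b * η) = a * η := by field_simp
      simp only [smul_eq_mul, mul_zero, add_zero, Real.exp_zero, mul_one, e] at hc
      have := mul_le_mul_of_nonneg_right hc (h0 η)
      dsimp only
      linarith
    rw [integral_add ((hexp b).const_mul _) (hki.const_mul _), integral_const_mul,
      integral_const_mul, h1] at key
    dsimp only
    rw [div_lt_div_iff₀ ha hb]
    have h2 := mul_le_mul_of_nonneg_right key hb.le
    have e2 : (a / b * (∫ η, Real.exp (b * η) * k η) + (1 - a / b) * 1) * b =
      a * (∫ η, Real.exp (b * η) * k η) + b - a := by field_simp; ring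
    rw [e2] at h2
    nlinarith [mul_lt_mul_of_pos_right hab hq]
  · intro μ hμ
    have hi : Integrable (fun η => η * Real.exp (μ * η) * k η) := by
      refine Integrable.mono' ((hexp (μ + 1)).add (hexp (μ - 1)))
        (by fun_prop) (Eventually.of_forall fun η => ?_)
      have hη : |η| ≤ Real.exp η + Real.exp (-η) := by
        rw [abs_le]
        constructor <;>
          linarith [Real.add_one_le_exp η, Real.add_one_le_exp (-η), Real.exp_pos η,
            Real.exp_pos (-η)]
      have := mul_le_mul_of_nonneg_right hη (mul_nonneg (Real.exp_pos (μ * η)).le (h0 η))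
      rw [Real.norm_eq_abs, abs_mul, abs_mul, abs_of_nonneg (h0 η), Real.abs_exp]
      have e1 : Real.exp ((μ + 1) * η) = Real.exp η * Real.exp (μ * η) := by
        rw [← Real.exp_add]; ring_nf
      have e2 : Real.exp ((μ - 1) * η) = Real.exp (-η) * Real.exp (μ * η) := by
        rw [← Real.exp_add]; ring_nf
      simp only [Pi.add_apply, e1, e2]
      linarith
    have key : (∫ η, (Real.exp (μ * η) * k η - μ * (η * Real.exp (μ * η) * k η))) ≤ ∫ η, k η := by
      refine integral_mono ((hexp μ).sub (hi.const_mul _)) hki ?_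
      intro η
      have h3 := Real.add_one_le_exp (-(μ * η))
      have h4 := mul_le_mul_of_nonneg_right h3 (Real.exp_pos (μ * η)).le
      rw [← Real.exp_add, neg_add_cancel, Real.exp_zero] at h4
      have := mul_le_mul_of_nonneg_right h4 (h0 η)
      dsimp only
      linarith
    rw [integral_sub (hexp μ) (hi.const_mul _), integral_const_mul, h1] at key
    linarith
end
end

section
/- (The spreading-speed exponent μ* is smaller than |μ₋| when c>c*.) Assume (H1) and (EXP), and let r,q>0. Let c* := inf_{μ>0} (∫_ℝ e^{−μ z} k(z) dz − 1 + r)/μ and suppose μ*>0 attains this infimum, i.e. c* = (∫_ℝ e^{−μ* z} k(z) dz − 1 + r)/μ*. Suppose c > c*, and let μ₋ < 0 satisfy c μ₋ + ∫_ℝ e^{μ₋ η} k(η) dη − 1 − q = 0. Then μ* < −μ₋. -/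
open MeasureTheory Real Set Filter Topology

noncomputable section

/-- The spreading-speed exponent `μ*` is smaller than `|μ₋|` when `c > c*`. -/
theorem mustar_lt_abs_mum
    (k : ℝ → ℝ) (hk : H1 k) (hexp : EXPk k)
    (r q : ℝ) (hr : 0 < r) (hq : 0 < q)
    (μstar : ℝ) (hμstar : 0 < μstar)
    (hattain : cstar k r = ((∫ z, Real.exp (-(μstar * z)) * k z) - 1 + r) / μstar)
    (c : ℝ) (hc : cstar k r < c)
    (μm : ℝ) (hμm : μm < 0)
    (hroot : c * μm + (∫ η, Real.exp (μm * η) * k η) - 1 - q = 0) :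
    μstar < -μm := by
  by_contra hcon
  have hle : -μm ≤ μstar := not_lt.mp hcon
  obtain ⟨-, hk0, -, hk1, -, -⟩ := hk
  have ht0 : 0 ≤ -μm / μstar := by
    apply div_nonneg <;> linarith
  have ht1 : -μm / μstar ≤ 1 := (div_le_one hμstar).mpr hle
  have htm : -μm / μstar * μstar = -μm := div_mul_cancel₀ _ hμstar.ne'
  generalize -μm / μstar = t at ht0 ht1 htm
  have hI1 : Integrable (fun z => Real.exp (-(μstar * z)) * k z) := by
    simpa [neg_mul] using hexp (-μstar)
  have hI0 : Integrable k := by simpa using hexp 0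
  have hpt : ∀ z, Real.exp (μm * z) * k z
      ≤ t * (Real.exp (-(μstar * z)) * k z) + (1 - t) * k z := by
    intro z
    have h := convexOn_exp.2 (mem_univ (-(μstar * z))) (mem_univ (0:ℝ)) ht0
      (sub_nonneg.mpr ht1) (by ring)
    have he : t * -(μstar * z) = μm * z := by linear_combination (-z) * htm
    simp only [smul_eq_mul, mul_zero, add_zero, Real.exp_zero, mul_one, he] at h
    nlinarith [mul_le_mul_of_nonneg_right h (hk0 z)]
  have hint := integral_mono (hexp μm) ((hI1.const_mul t).add (hI0.const_mul (1 - t))) hpt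
  have hadd := integral_add (hI1.const_mul t) (hI0.const_mul (1 - t))
  rw [integral_const_mul, integral_const_mul, hk1] at hadd
  simp only [Pi.add_apply] at hint
  rw [hadd] at hint
  rw [eq_div_iff hμstar.ne'] at hattain
  generalize (∫ z, Real.exp (-(μstar * z)) * k z) = A at *
  generalize (∫ z, Real.exp (μm * z) * k z) = B at *
  have e1 : A - 1 = cstar k r * μstar - r := by linarith
  have e2 : B - 1 ≤ t * (A - 1) := by linarith
  have e3 : t * (A - 1) = cstar k r * (-μm) - t * r := by
    rw [e1, ← htm]; ring
  nlinarith [mul_nonneg ht0 hr.le, mul_pos (sub_pos.mpr hc) (neg_pos.mpr hμm)]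
end
end

section
/- (Resolvent of the local transport operator on periodic functions.) Let c>0, p>0, let a:ℝ→ℝ be continuous with a(ξ+p)=a(ξ) for all ξ, set ā = (1/p)∫₀^p a(s) ds, and let α∈ℝ with α > −1 + ā. For every continuous p-periodic function w:ℝ→ℝ, the formula φ(ξ) = (1/c) ∫_ξ^∞ exp((1/c)∫_ζ^ξ (α+1−a(s)) ds) w(ζ) dζ defines (the integral converging absolutely for every ξ) a C¹ p-periodic function φ which is the unique C¹ p-periodic solution of c φ'(ξ) = (α+1−a(ξ)) φ(ξ) − w(ξ) on ℝ, and it satisfies sup_{ξ∈ℝ} |φ(ξ)| ≤ (exp((|ā| + max_{ξ∈[0,p]} |a(ξ)|) p / c)/(α+1−ā)) · sup_{ξ∈ℝ} |w(ξ)|. -/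
open MeasureTheory Real Set Filter Topology

noncomputable section

/-- Resolvent of the local transport operator on periodic functions. -/
theorem resolvent_transport_periodic
    (c p : ℝ) (hc : 0 < c) (hp : 0 < p)
    (a : ℝ → ℝ) (haC : Continuous a) (hap : ∀ ξ, a (ξ + p) = a ξ)
    (abar : ℝ) (habar : abar = (1 / p) * ∫ s in (0:ℝ)..p, a s)
    (α : ℝ) (hα : -1 + abar < α)
    (w : ℝ → ℝ) (hwC : Continuous w) (hwp : ∀ ξ, w (ξ + p) = w ξ) :
    (∀ ξ : ℝ, MeasureTheory.IntegrableOn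
        (fun ζ => Real.exp ((1 / c) * ∫ s in ζ..ξ, (α + 1 - a s)) * w ζ) (Set.Ici ξ)) ∧
    ∀ φ : ℝ → ℝ,
      (∀ ξ, φ ξ =
        (1 / c) * ∫ ζ in Set.Ici ξ, Real.exp ((1 / c) * ∫ s in ζ..ξ, (α + 1 - a s)) * w ζ) →
      ((∀ ξ, φ (ξ + p) = φ ξ) ∧
       (∀ ξ, HasDerivAt φ (((α + 1 - a ξ) * φ ξ - w ξ) / c) ξ) ∧
       (∀ ψ : ℝ → ℝ, (∀ ξ, ψ (ξ + p) = ψ ξ) →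
          (∀ ξ, HasDerivAt ψ (((α + 1 - a ξ) * ψ ξ - w ξ) / c) ξ) → ψ = φ) ∧
       (∀ ξ, |φ ξ| ≤
          (Real.exp ((|abar| + ⨆ s : Set.Icc (0:ℝ) p, |a (s : ℝ)|) * p / c) / (α + 1 - abar)) *
            ⨆ ξ' : ℝ, |w ξ'|)) := by
  have haP : Function.Periodic a p := hap
  have hwP : Function.Periodic w p := hwp
  have hgC : Continuous (fun s => α + 1 - a s) := by fun_prop
  have hgI : ∀ x y : ℝ, IntervalIntegrable (fun s => α + 1 - a s) volume x y :=
    fun x y => hgC.intervalIntegrable x y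
  have haI : ∀ x y : ℝ, IntervalIntegrable a volume x y :=
    fun x y => haC.intervalIntegrable x y
  have hκ : 0 < α + 1 - abar := by linarith
  obtain ⟨G, hG⟩ : ∃ G : ℝ → ℝ, ∀ x, G x = (1 / c) * ∫ s in (0:ℝ)..x, (α + 1 - a s) :=
    ⟨_, fun _ => rfl⟩
  obtain ⟨β, hβ⟩ : ∃ β : ℝ, β = (α + 1 - abar) / c := ⟨_, rfl⟩
  have hβ0 : 0 < β := by rw [hβ]; positivity
  obtain ⟨A, hA⟩ : ∃ A : ℝ, A = ⨆ s : Set.Icc (0:ℝ) p, |a (s : ℝ)| := ⟨_, rfl⟩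
  obtain ⟨W, hW⟩ : ∃ W : ℝ, W = ⨆ ξ' : ℝ, |w ξ'| := ⟨_, rfl⟩
  rw [← hA, ← hW]
  have hAb : ∀ s, |a s| ≤ A := by
    intro s
    obtain ⟨y, hy, hsy⟩ := haP.exists_mem_Ico₀ hp s
    have hb : BddAbove (Set.range fun s : Set.Icc (0:ℝ) p => |a (s : ℝ)|) :=
      (isCompact_range (by fun_prop)).bddAbove
    rw [hsy, hA]
    exact le_ciSup hb (⟨y, hy.1, hy.2.le⟩ : Set.Icc (0:ℝ) p)
  have hWb : ∀ s, |w s| ≤ W := by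
    intro s
    have hb : BddAbove (Set.range fun s : ℝ => |w s|) := by
      obtain ⟨C, hC⟩ := (hwP.isBounded_of_continuous hp.ne' hwC).exists_norm_le
      refine ⟨C, ?_⟩
      rintro _ ⟨x, rfl⟩
      exact hC _ ⟨x, rfl⟩
    rw [hW]
    exact le_ciSup hb s
  have hE : ∀ ζ ξ : ℝ, (1 / c) * (∫ s in ζ..ξ, (α + 1 - a s)) = G ξ - G ζ := by
    intro ζ ξ
    rw [hG, hG, ← mul_sub, intervalIntegral.integral_interval_sub_left (hgI _ _) (hgI _ _)]
  have hGd : ∀ x, HasDerivAt G ((α + 1 - a x) / c) x := by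
    intro x
    have h := (intervalIntegral.integral_hasDerivAt_right (hgI 0 x)
      (hgC.stronglyMeasurableAtFilter _ _) hgC.continuousAt).const_mul (1 / c)
    have hGf : G = fun x => (1 / c) * ∫ s in (0:ℝ)..x, (α + 1 - a s) := funext hG
    rw [hGf]
    exact h.congr_deriv (by ring)
  have hGC : Continuous G := continuous_iff_continuousAt.2 fun x => (hGd x).continuousAt
  have hGper : ∀ x, G (x + p) = G x + β * p := by
    intro x
    have h := hE x (x + p)
    rw [intervalIntegral.integral_sub (by simp) (haI _ _),
      haP.intervalIntegral_add_eq x 0, zero_add] at h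
    have h2 : (∫ s in (0:ℝ)..p, a s) = abar * p := by rw [habar]; field_simp
    rw [h2] at h
    simp only [intervalIntegral.integral_const, smul_eq_mul] at h
    rw [hβ]
    have : G (x + p) = G x + (1 / c) * ((x + p - x) * (α + 1) - abar * p) := by linarith
    rw [this]; ring
  have hbd : ∀ ζ ξ : ℝ, G ξ - G ζ ≤ (|abar| + A) * p / c - β * (ζ - ξ) := by
    intro ζ ξ
    have hBP : Function.Periodic (fun x => β * x - G x) p := by
      intro x
      simp only [hGper]; ring
    obtain ⟨y, hy, hζy⟩ := hBP.exists_mem_Ico hp ζ ξ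
    have h := hE ξ y
    rw [intervalIntegral.integral_sub (by simp) (haI _ _)] at h
    simp only [intervalIntegral.integral_const, smul_eq_mul] at h
    have h3 : |∫ s in ξ..y, (a s)| ≤ A * |y - ξ| := by
      rw [← Real.norm_eq_abs (∫ s in ξ..y, (a s))]
      exact intervalIntegral.norm_integral_le_of_norm_le_const fun x _ => hAb x
    rw [abs_of_nonneg (by linarith [hy.1] : 0 ≤ y - ξ)] at h3
    have hA0 : 0 ≤ A := (abs_nonneg _).trans (hAb 0)
    have h4 : (∫ s in ξ..y, (a s)) - abar * (y - ξ) ≤ (|abar| + A) * p := by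
      have h5 := le_abs_self (∫ s in ξ..y, (a s))
      have h6 : -abar * (y - ξ) ≤ |abar| * (y - ξ) :=
        mul_le_mul_of_nonneg_right (neg_le_abs _) (by linarith [hy.1])
      have h7 : (|abar| + A) * (y - ξ) ≤ (|abar| + A) * p :=
        mul_le_mul_of_nonneg_left (by linarith [hy.2]) (by positivity)
      linarith
    have h8 : G ξ - G ζ + β * (ζ - ξ) = ((∫ s in ξ..y, (a s)) - abar * (y - ξ)) / c := by
      have : G ξ - G ζ + β * (ζ - ξ) = β * (y - ξ) - (G y - G ξ) := by linarith
      rw [this, ← h, hβ]; ring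
    have h9 := div_le_div_of_nonneg_right h4 hc.le
    linarith
  obtain ⟨K, hK⟩ : ∃ K, K = Real.exp ((|abar| + A) * p / c) := ⟨_, rfl⟩
  have hW0 : 0 ≤ W := (abs_nonneg _).trans (hWb 0)
  have hK0 : 0 < K := by rw [hK]; positivity
  have hdom : ∀ ξ ζ : ℝ, ‖Real.exp (G ξ - G ζ) * w ζ‖ ≤
      K * W * Real.exp (β * ξ) * Real.exp (-β * ζ) := by
    intro ξ ζ
    rw [norm_mul, Real.norm_eq_abs, Real.norm_eq_abs, abs_of_pos (Real.exp_pos _)]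
    have h1 : Real.exp (G ξ - G ζ) ≤ K * (Real.exp (β * ξ) * Real.exp (-β * ζ)) := by
      rw [hK, ← Real.exp_add, ← Real.exp_add]
      apply Real.exp_le_exp.2
      have := hbd ζ ξ
      linarith
    calc _ ≤ K * (Real.exp (β * ξ) * Real.exp (-β * ζ)) * W :=
          mul_le_mul h1 (hWb ζ) (abs_nonneg _) (by positivity)
      _ = _ := by ring
  have hdomI : ∀ ξ : ℝ, IntegrableOn
      (fun ζ => K * W * Real.exp (β * ξ) * Real.exp (-β * ζ)) (Set.Ioi ξ) := fun ξ =>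
    (exp_neg_integrableOn_Ioi ξ hβ0).const_mul _
  have hint : ∀ ξ x : ℝ, IntegrableOn (fun ζ => Real.exp (G x - G ζ) * w ζ) (Set.Ioi ξ) := by
    intro ξ x
    refine ((exp_neg_integrableOn_Ioi ξ hβ0).const_mul (K * W * Real.exp (β * x))).mono' ?_
      (Filter.Eventually.of_forall fun ζ => hdom x ζ)
    exact Continuous.aestronglyMeasurable (by fun_prop)
  simp only [hE, integral_Ici_eq_integral_Ioi]
  refine ⟨fun ξ => integrableOn_Ici_iff_integrableOn_Ioi (by finiteness) |>.mpr (hint ξ ξ), ?_⟩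
  intro φ hφ
  have hφper : ∀ ξ, φ (ξ + p) = φ ξ := by
    intro ξ
    rw [hφ, hφ]
    congr 1
    have h := (measurePreserving_add_right volume p).setIntegral_preimage_emb
      (measurableEmbedding_addRight p) (fun ζ => Real.exp (G (ξ + p) - G ζ) * w ζ)
      (Set.Ioi (ξ + p))
    rw [← h]
    simp only [Set.preimage_add_const_Ioi, add_sub_cancel_right, hGper, hwp,
      add_sub_add_right_eq_sub]
  have hφd : ∀ ξ, HasDerivAt φ (((α + 1 - a ξ) * φ ξ - w ξ) / c) ξ := by
    intro ξ
    have hhC : Continuous (fun ζ => Real.exp (- G ζ) * w ζ) := by fun_prop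
    have hh : ∀ x, IntegrableOn (fun ζ => Real.exp (- G ζ) * w ζ) (Set.Ioi x) := by
      intro x
      have := (hint x 0).const_mul (Real.exp (- G 0))
      refine this.congr (Filter.Eventually.of_forall fun ζ => ?_)
      simp only
      rw [← mul_assoc, ← Real.exp_add]
      congr 2; ring
    have hφ2 : ∀ x, φ x = (1 / c) * (Real.exp (G x) *
        ((∫ ζ in Set.Ioi (0:ℝ), Real.exp (- G ζ) * w ζ) -
          ∫ ζ in (0:ℝ)..x, Real.exp (- G ζ) * w ζ)) := by
      intro x
      rw [hφ, ← intervalIntegral.integral_interval_add_Ioi (hh 0) (hh x), add_sub_cancel_left,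
        ← integral_const_mul (Real.exp (G x))]
      congr 1
      refine integral_congr_ae (Filter.Eventually.of_forall fun ζ => ?_)
      simp only
      rw [← mul_assoc, ← Real.exp_add, sub_eq_add_neg]
    have hI := intervalIntegral.integral_hasDerivAt_right (hhC.intervalIntegrable 0 ξ)
      (hhC.stronglyMeasurableAtFilter _ _) hhC.continuousAt
    have hD := ((hGd ξ).exp.mul (hI.const_sub
      (∫ ζ in Set.Ioi (0:ℝ), Real.exp (- G ζ) * w ζ))).const_mul (1 / c)
    have h1 : Real.exp (G ξ) * Real.exp (- G ξ) = 1 := by rw [← Real.exp_add]; simp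
    have hφf := funext hφ2
    rw [hφ2 ξ, hφf]
    refine hD.congr_deriv ?_
    generalize (∫ ζ in Set.Ioi (0:ℝ), Real.exp (- G ζ) * w ζ) = J at *
    generalize (∫ ζ in (0:ℝ)..ξ, Real.exp (- G ζ) * w ζ) = J2 at *
    linear_combination (-(w ξ / c)) * h1
  refine ⟨hφper, hφd, ?_, ?_⟩
  · intro ψ hψper hψd
    have hd : ∀ x, HasDerivAt (fun x => (ψ x - φ x) * Real.exp (- G x)) 0 x := by
      intro x
      have := ((hψd x).sub (hφd x)).mul (hGd x).neg.exp
      refine this.congr_deriv ?_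
      simp only [Pi.sub_apply]
      ring
    have hconst := is_const_of_deriv_eq_zero (fun x => (hd x).differentiableAt)
      (fun x => (hd x).deriv)
    ext x
    have h := hconst x (x + p)
    simp only [hψper, hφper, hGper] at h
    have hne : Real.exp (- G x) - Real.exp (-(G x + β * p)) ≠ 0 := by
      have : Real.exp (-(G x + β * p)) < Real.exp (- G x) :=
        Real.exp_lt_exp.2 (by nlinarith [mul_pos hβ0 hp])
      linarith
    have h2 : (ψ x - φ x) * (Real.exp (- G x) - Real.exp (-(G x + β * p))) = 0 := by
      linarith
    rcases mul_eq_zero.1 h2 with h3 | h3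
    · linarith
    · exact absurd h3 hne
  · intro ξ
    rw [hφ, abs_mul, abs_of_pos (by positivity : 0 < 1 / c), ← hK]
    have h := norm_integral_le_of_norm_le (hdomI ξ)
      (Filter.Eventually.of_forall fun ζ => hdom ξ ζ)
    rw [integral_const_mul, integral_exp_mul_Ioi (by linarith : -β < 0), Real.norm_eq_abs] at h
    have h1 : Real.exp (β * ξ) * Real.exp (-β * ξ) = 1 := by rw [← Real.exp_add]; simp
    have h2 : K * W * Real.exp (β * ξ) * (-Real.exp (-β * ξ) / -β) = K * W / β := by
      rw [neg_div_neg_eq]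
      linear_combination (K * W / β) * h1
    rw [h2] at h
    calc _ ≤ 1 / c * (K * W / β) := mul_le_mul_of_nonneg_left h (by positivity)
      _ = _ := by rw [hβ]; field_simp
end
end
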